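/- arXiv:math/9502237 — 8 statements merged into one kernel-verified Lean document; each statement's English description precedes it below -/
import Mathlib

section
/- Let n be a positive integer. There exist two partitions A_1,...,A_p and B_1,...,B_q of {1,...,n} with the Knowlton–Graham property if and only if there exist a positive integer m and an m×m matrix of 0s and 1s, with row sums (r_1,...,r_m) and column sums (c_1,...,c_m), such that j divides r_j and j divides c_j for every j with 1 ≤ j ≤ m, and r_1 + ... + r_m = c_1 + ... + c_m = n. -/
open Finset

/-- Two partitions of `{1,...,n}` (modeled as `Fin n`) have the Knowlton–Graham
property if for every pair `(j,k)`, at most one element lies both in an `A`-block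
of cardinality `j` and in a `B`-block of cardinality `k`. -/
def KnowltonGraham {n : ℕ} (P Q : Finpartition (Finset.univ : Finset (Fin n))) : Prop :=
  ∀ j k : ℕ, ({x : Fin n |
      (∃ A ∈ P.parts, x ∈ A ∧ A.card = j) ∧
      (∃ B ∈ Q.parts, x ∈ B ∧ B.card = k)} : Set (Fin n)).Subsingleton

theorem kg_iff {n : ℕ} (P Q : Finpartition (Finset.univ : Finset (Fin n))) :
    KnowltonGraham P Q ↔ ∀ x y, #(P.part x) = #(P.part y) → #(Q.part x) = #(Q.part y) → x = y := by
  constructor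
  · intro h x y h1 h2
    refine h (#(P.part x)) (#(Q.part x)) ⟨⟨P.part x, by simp, by simp, rfl⟩, Q.part x, by simp, by simp, rfl⟩
      ⟨⟨P.part y, by simp, by simp, h1.symm⟩, Q.part y, by simp, by simp, h2.symm⟩
  · rintro h j k x ⟨⟨A, hA, hxA, rfl⟩, B, hB, hxB, rfl⟩ y ⟨⟨A', hA', hyA, h1⟩, B', hB', hyB, h2⟩
    apply h
    · rw [P.part_eq_of_mem hA hxA, P.part_eq_of_mem hA' hyA, h1]
    · rw [Q.part_eq_of_mem hB hxB, Q.part_eq_of_mem hB' hyB, h2]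

theorem part_fwd {n : ℕ} (P : Finpartition (Finset.univ : Finset (Fin n))) :
    ∃ a : Fin n → Fin n, (∀ x, (a x).val + 1 = #(P.part x)) ∧
      ∀ i : Fin n, (i.val + 1) ∣ #{x | a x = i} := by
  have hpos : ∀ x, 0 < #(P.part x) := fun x => card_pos.2 ⟨x, by simp⟩
  have hle : ∀ x, #(P.part x) ≤ n := fun x => by simpa using card_le_univ (P.part x)
  refine ⟨fun x => ⟨#(P.part x) - 1, by have := hpos x; have := hle x; omega⟩, ?_, ?_⟩
  · intro x
    have := hpos x
    simp only
    omega
  · intro i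
    rw [card_eq_sum_card_fiberwise (f := P.part) (t := P.parts) (by intro x _; simp)]
    apply dvd_sum
    intro A hA
    by_cases hc : #A = i.val + 1
    · rw [← hc]
      apply dvd_of_eq
      congr 1
      ext x
      simp only [mem_filter, mem_univ, true_and]
      rw [P.part_eq_iff_mem hA]
      constructor
      · intro hx
        refine ⟨?_, hx⟩
        ext
        simp [P.part_eq_of_mem hA hx, hc]
      · exact fun h => h.2
    · convert dvd_zero _
      rw [card_eq_zero, filter_eq_empty_iff]
      rintro x hx rfl
      simp only [mem_filter, mem_univ, true_and] at hx
      apply hc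
      have := hpos x
      rw [← hx]
      simp only
      omega

theorem part_bwd {n m : ℕ} (a : Fin n → Fin m)
    (h : ∀ i : Fin m, (i.val + 1) ∣ #{x | a x = i}) :
    ∃ P : Finpartition (Finset.univ : Finset (Fin n)), ∀ x, #(P.part x) = (a x).val + 1 := by
  classical
  let P0 := Finpartition.ofSetoid (Setoid.ker a)
  have key : ∀ A ∈ P0.parts, ∃ Q : Finpartition A, ∀ B ∈ Q.parts, ∀ x ∈ B, #B = (a x).val + 1 := by
    intro A hA
    obtain ⟨x, hx⟩ := P0.nonempty_of_mem_parts hA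
    have hAe : A = univ.filter (fun y => a y = a x) := by
      rw [← P0.part_eq_of_mem hA hx]
      ext y
      refine (Finpartition.mem_part_ofSetoid_iff_rel (s := Setoid.ker a)).trans ?_
      simp [Setoid.ker, Function.onFun, eq_comm]
    obtain ⟨c, hc⟩ := h (a x)
    rw [← hAe] at hc
    have hs : c * ((a x).val + 1) + 0 * ((a x).val + 1 + 1) = #A := by rw [hc]; ring
    refine ⟨(⊥ : Finpartition A).equitabilise hs, fun B hB y hy => ?_⟩
    have hy' : a y = a x := by
      have := Finpartition.le _ hB hy
      rw [hAe] at this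
      simpa using this
    rw [hy']
    rcases Finpartition.card_eq_of_mem_parts_equitabilise hB with h1 | h1
    · exact h1
    · have h2 := Finpartition.card_filter_equitabilise_big ⊥ hs
      rw [card_eq_zero, filter_eq_empty_iff] at h2
      exact absurd h1 (h2 hB)
  choose Q hQ using key
  refine ⟨P0.bind Q, fun x => ?_⟩
  have hm : (P0.bind Q).part x ∈ (P0.bind Q).parts := (Finpartition.part_mem _).2 (mem_univ x)
  obtain ⟨A, hA, hB⟩ := Finpartition.mem_bind.1 hm
  exact hQ A hA _ hB x (by simp)

theorem stmt0 (n : ℕ) (hn : 0 < n) :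
    (∃ P Q : Finpartition (Finset.univ : Finset (Fin n)), KnowltonGraham P Q) ↔
    (∃ m : ℕ, 0 < m ∧ ∃ M : Fin m → Fin m → ℕ,
      (∀ i j, M i j = 0 ∨ M i j = 1) ∧
      (∀ j : Fin m, (j.val + 1) ∣ ∑ k, M j k) ∧
      (∀ j : Fin m, (j.val + 1) ∣ ∑ k, M k j) ∧
      (∑ j, ∑ k, M j k) = n ∧ (∑ j, ∑ k, M k j) = n) := by
  constructor
  · rintro ⟨P, Q, hPQ⟩
    rw [kg_iff] at hPQ
    obtain ⟨a, ha, ha'⟩ := part_fwd P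
    obtain ⟨b, hb, hb'⟩ := part_fwd Q
    have hr : ∀ i, ∑ k, #{x | a x = i ∧ b x = k} = #{x | a x = i} := by
      intro i
      rw [card_eq_sum_card_fiberwise (f := b) (t := univ) (by intro x _; simp)]
      simp only [filter_filter]
    have hc : ∀ i, ∑ k, #{x | a x = k ∧ b x = i} = #{x | b x = i} := by
      intro i
      rw [card_eq_sum_card_fiberwise (f := a) (t := univ) (by intro x _; simp)]
      simp only [filter_filter, and_comm]
    have hat : ∑ i, #{x | a x = i} = n := by
      rw [← card_eq_sum_card_fiberwise (f := a) (t := univ) (by intro x _; simp)]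
      simp
    have hbt : ∑ i, #{x | b x = i} = n := by
      rw [← card_eq_sum_card_fiberwise (f := b) (t := univ) (by intro x _; simp)]
      simp
    refine ⟨n, hn, fun i k => #{x | a x = i ∧ b x = k}, ?_, ?_, ?_, ?_, ?_⟩
    · intro i k
      have : #{x | a x = i ∧ b x = k} ≤ 1 := by
        rw [card_le_one]
        intro x hx y hy
        simp only [mem_filter, mem_univ, true_and] at hx hy
        apply hPQ
        · rw [← ha, ← ha, hx.1, hy.1]
        · rw [← hb, ← hb, hx.2, hy.2]
      simp only
      omega
    · intro j; simp only [hr]; exact ha' j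
    · intro j; simp only [hc]; exact hb' j
    · simp only [hr]; exact hat
    · simp only [hc]; exact hbt
  · rintro ⟨m, hm, M, h01, hr, hc, hs, -⟩
    have hM : ∀ i k, M i k = if M i k = 1 then 1 else 0 := by
      intro i k
      rcases h01 i k with h | h <;> simp [h]
    have hcard : Fintype.card {p : Fin m × Fin m // M p.1 p.2 = 1} = n := by
      rw [Fintype.card_subtype, card_filter, ← hs, Fintype.sum_prod_type]
      exact sum_congr rfl fun i _ => sum_congr rfl fun k _ => (hM i k).symm
    let e := (Fintype.equivFinOfCardEq hcard).symm
    obtain ⟨P, hP⟩ := part_bwd (fun x => (e x).1.1) (by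
      intro i
      convert hr i using 1
      rw [sum_congr rfl fun k _ => hM i k, ← card_filter]
      refine card_bij (fun x _ => (e x).1.2) ?_ ?_ ?_
      · intro x hx
        simp only [mem_filter, mem_univ, true_and] at hx ⊢
        rw [← hx]; exact (e x).2
      · intro x hx y hy hxy
        simp only [mem_filter, mem_univ, true_and] at hx hy
        exact e.injective (Subtype.ext (Prod.ext (hx.trans hy.symm) hxy))
      · intro k hk
        simp only [mem_filter, mem_univ, true_and] at hk
        exact ⟨e.symm ⟨(i, k), hk⟩, by simp, by simp⟩)
    obtain ⟨Q, hQ⟩ := part_bwd (fun x => (e x).1.2) (by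
      intro i
      convert hc i using 1
      rw [sum_congr rfl fun k _ => hM k i, ← card_filter]
      refine card_bij (fun x _ => (e x).1.1) ?_ ?_ ?_
      · intro x hx
        simp only [mem_filter, mem_univ, true_and] at hx ⊢
        rw [← hx]; exact (e x).2
      · intro x hx y hy hxy
        simp only [mem_filter, mem_univ, true_and] at hx hy
        exact e.injective (Subtype.ext (Prod.ext hxy (hx.trans hy.symm)))
      · intro k hk
        simp only [mem_filter, mem_univ, true_and] at hk
        exact ⟨e.symm ⟨(k, i), hk⟩, by simp, by simp⟩)
    refine ⟨P, Q, (kg_iff P Q).2 fun x y h1 h2 => ?_⟩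
    rw [hP, hP] at h1
    rw [hQ, hQ] at h2
    exact e.injective (Subtype.ext (Prod.ext (Fin.ext (by simpa using h1)) (Fin.ext (by simpa using h2))))
end

section
/- If two partitions A_1,...,A_p and B_1,...,B_q of {1,...,n} have the Knowlton–Graham property and have order m (i.e., the largest cardinality of any block among A_1,...,A_p,B_1,...,B_q equals m), then binomial(m+1,2) ≤ n ≤ J(m), where J(m) = Σ_{j=1}^m j·⌊m/j⌋. -/
open Finset

/-- The pair of partitions has order `m` if the largest cardinality among all
blocks of both partitions equals `m`. -/
def KGOrder {n : ℕ} (P Q : Finpartition (Finset.univ : Finset (Fin n))) (m : ℕ) : Prop :=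
  (∀ A ∈ P.parts ∪ Q.parts, A.card ≤ m) ∧ (∃ A ∈ P.parts ∪ Q.parts, A.card = m)

/-- `J m = ∑_{j=1}^m j ⌊m/j⌋`. -/
def J (m : ℕ) : ℕ := ∑ j ∈ Finset.Icc 1 m, j * (m / j)

theorem kg_part {n : ℕ} (P : Finpartition (Finset.univ : Finset (Fin n))) (x : Fin n) :
    P.part x ∈ P.parts ∧ x ∈ P.part x :=
  ⟨P.part_mem.2 (mem_univ x), P.mem_part (mem_univ x)⟩

theorem kg_inj {n : ℕ} {P Q : Finpartition (Finset.univ : Finset (Fin n))}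
    (h : KnowltonGraham P Q) (x y : Fin n) (ha : (P.part x).card = (P.part y).card)
    (hb : (Q.part x).card = (Q.part y).card) : x = y :=
  h (P.part y).card (Q.part y).card
    ⟨⟨_, (kg_part P x).1, (kg_part P x).2, ha⟩, ⟨_, (kg_part Q x).1, (kg_part Q x).2, hb⟩⟩
    ⟨⟨_, (kg_part P y).1, (kg_part P y).2, rfl⟩, ⟨_, (kg_part Q y).1, (kg_part Q y).2, rfl⟩⟩

theorem kg_symm {n : ℕ} {P Q : Finpartition (Finset.univ : Finset (Fin n))}
    (h : KnowltonGraham P Q) : KnowltonGraham Q P :=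
  fun j k _ hx _ hy => h k j ⟨hx.2, hx.1⟩ ⟨hy.2, hy.1⟩

theorem kg_mem {n m : ℕ} (P : Finpartition (Finset.univ : Finset (Fin n)))
    (h : ∀ A ∈ P.parts, A.card ≤ m) (x : Fin n) : (P.part x).card ∈ Finset.Icc 1 m :=
  Finset.mem_Icc.2 ⟨Finset.card_pos.2 ⟨x, (kg_part P x).2⟩, h _ (kg_part P x).1⟩

theorem kg_sum {n m : ℕ} (P : Finpartition (Finset.univ : Finset (Fin n)))
    (h : ∀ A ∈ P.parts, A.card ≤ m) :
    n = ∑ j ∈ Finset.Icc 1 m, (univ.filter fun x => (P.part x).card = j).card := by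
  have := Finset.card_eq_sum_card_fiberwise (s := (univ : Finset (Fin n)))
    (f := fun x => (P.part x).card) (t := Finset.Icc 1 m) (fun x _ => kg_mem P h x)
  simpa using this

theorem kg_lower {n m : ℕ} {P Q : Finpartition (Finset.univ : Finset (Fin n))}
    (hKG : KnowltonGraham P Q) (hQ : ∀ A ∈ Q.parts, A.card ≤ m)
    (A : Finset (Fin n)) (hA : A ∈ P.parts) (hm : A.card = m) :
    Nat.choose (m + 1) 2 ≤ n := by
  have himg : A.image (fun x => (Q.part x).card) = Finset.Icc 1 m := by
    apply Finset.eq_of_subset_of_card_le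
    · intro k hk
      obtain ⟨x, -, rfl⟩ := Finset.mem_image.1 hk
      exact kg_mem Q hQ x
    · rw [Finset.card_image_of_injOn]
      · simp [hm]
      · intro x hx y hy hxy
        apply kg_inj hKG x y _ hxy
        rw [P.part_eq_of_mem hA hx, P.part_eq_of_mem hA hy]
  rw [kg_sum Q hQ]
  have h1 : Nat.choose (m + 1) 2 = ∑ j ∈ Finset.Icc 1 m, j := by
    clear himg hm hQ
    induction m with
    | zero => simp
    | succ k ih =>
      rw [Finset.sum_Icc_succ_top (by omega), ← ih, Nat.choose_succ_succ (k+1) 1]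
      simp; omega
  rw [h1]
  apply Finset.sum_le_sum
  intro k hk
  rw [← himg] at hk
  obtain ⟨x, -, rfl⟩ := Finset.mem_image.1 hk
  apply Finset.card_le_card
  intro y hy
  simp only [Finset.mem_filter, Finset.mem_univ, true_and]
  rw [Q.part_eq_of_mem (kg_part Q x).1 hy]

theorem kg_dvd {n : ℕ} (P : Finpartition (Finset.univ : Finset (Fin n))) (j : ℕ) :
    j ∣ (univ.filter fun x => (P.part x).card = j).card := by
  have : (univ.filter fun x => (P.part x).card = j)
      = (P.parts.filter fun A => A.card = j).biUnion id := by
    ext x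
    simp only [Finset.mem_filter, Finset.mem_univ, true_and, Finset.mem_biUnion, id]
    constructor
    · intro h
      exact ⟨_, ⟨(kg_part P x).1, h⟩, (kg_part P x).2⟩
    · rintro ⟨A, ⟨hA, h⟩, hx⟩
      rw [P.part_eq_of_mem hA hx, h]
  rw [this, Finset.card_biUnion]
  · apply Finset.dvd_sum
    intro A hA
    rw [id, (Finset.mem_filter.1 hA).2]
  · intro A hA B hB hAB
    exact P.disjoint (Finset.mem_filter.1 hA).1 (Finset.mem_filter.1 hB).1 hAB

theorem stmt1 (n m : ℕ) (hn : 0 < n)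
    (P Q : Finpartition (Finset.univ : Finset (Fin n)))
    (hKG : KnowltonGraham P Q) (hord : KGOrder P Q m) :
    Nat.choose (m + 1) 2 ≤ n ∧ n ≤ J m := by
  obtain ⟨hle, A, hA, hm⟩ := hord
  have hP : ∀ A ∈ P.parts, A.card ≤ m := fun A h => hle A (Finset.mem_union_left _ h)
  have hQ : ∀ A ∈ Q.parts, A.card ≤ m := fun A h => hle A (Finset.mem_union_right _ h)
  constructor
  · rcases Finset.mem_union.1 hA with h | h
    · exact kg_lower hKG hQ A h hm
    · exact kg_lower (kg_symm hKG) hP A h hm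
  · rw [kg_sum P hP, J]
    apply Finset.sum_le_sum
    intro j hj
    obtain ⟨c, hc⟩ := kg_dvd P j
    have hcard : (univ.filter fun x => (P.part x).card = j).card ≤ m := by
      have := Finset.card_le_card_of_injOn (s := univ.filter fun x => (P.part x).card = j)
        (t := Finset.Icc 1 m) (fun x => (Q.part x).card) (fun x _ => kg_mem Q hQ x)
        (by
          intro x hx y hy hxy
          simp only [Finset.coe_filter, Finset.mem_univ, true_and, Set.mem_setOf_eq] at hx hy
          exact kg_inj hKG x y (hx.trans hy.symm) hxy)
      simpa using this
    rw [hc] at hcard ⊢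
    apply Nat.mul_le_mul_left
    rw [Nat.le_div_iff_mul_le (Finset.mem_Icc.1 hj).1, mul_comm]
    exact hcard
end

section
/- Let m ≥ 1 and let (r_1,...,r_m) and (c_1,...,c_m) be integers satisfying: r_1 + ... + r_m = c_1 + ... + c_m; m ≥ r_1 ≥ r_2 ≥ ... ≥ r_m ≥ 0 and m ≥ c_1 ≥ c_2 ≥ ... ≥ c_m ≥ 0; and r_{j+1} ≥ r_j − 1 and c_{j+1} ≥ c_j − 1 for all 1 ≤ j < m. Then there exists an m×m matrix of 0s and 1s whose row sums are (r_1,...,r_m) and whose column sums are (c_1,...,c_m). -/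
open Finset

lemma aux_step {m : ℕ} (r : Fin m → ℕ)
    (hrstep : ∀ j : Fin m, ∀ h : j.val + 1 < m, r j ≤ r ⟨j.val + 1, h⟩ + 1) :
    ∀ (d : ℕ) (i i' : Fin m), i'.val = i.val + d → r i ≤ r i' + d := by
  intro d
  induction d with
  | zero =>
    intro i i' h
    have : i' = i := Fin.ext (by omega)
    subst this; omega
  | succ d ih =>
    intro i i' h
    have hlt : i.val + 1 < m := by have := i'.isLt; omega
    have h1 := hrstep i hlt
    have h2 := ih ⟨i.val + 1, hlt⟩ i' (by simp; omega)
    omega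

lemma aux_half {m : ℕ} (r c : Fin m → ℕ) (k l : ℕ) (I K : Finset (Fin m))
    (hI : ∀ i, i ∈ I ↔ i.val < k) (hIc : I.card = k) (hK : ∀ i, i ∈ K ↔ i.val < l)
    (hrm : ∀ j, r j ≤ m)
    (hr : ∀ i ∈ I, r i + i.val ≤ l + k)
    (hc : ∀ j ∉ K, k + l ≤ c j + j.val) :
    ∑ i ∈ I, r i ≤ ∑ j ∈ Kᶜ, c j + k * l := by
  have h1 : ∀ i ∈ I, r i ≤ (∑ j ∈ Kᶜ, if j.val < r i then 1 else 0) + l := by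
    intro i _
    rw [← Finset.card_filter]
    have : ((range (r i)).filter (fun v => l ≤ v)).card ≤ (Kᶜ.filter (fun j : Fin m => j.val < r i)).card := by
      apply Finset.card_le_card_of_surjOn (fun j : Fin m => j.val)
      intro v hv
      simp only [coe_filter, Finset.mem_range, Set.mem_ofPred_eq] at hv
      refine ⟨⟨v, lt_of_lt_of_le hv.1 (hrm i)⟩, ?_, rfl⟩
      simp [hK, hv.1, hv.2]
    have h2 : r i - l ≤ ((range (r i)).filter (fun v => l ≤ v)).card := by
      rw [← Nat.card_Ico]
      apply Finset.card_le_card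
      intro v hv
      simp at hv ⊢
      omega
    omega
  have h2 : ∀ j ∈ Kᶜ, (∑ i ∈ I, if j.val < r i then 1 else 0) ≤ c j := by
    intro j hj
    rw [Finset.mem_compl] at hj
    have hcj := hc j hj
    have hlj : l ≤ j.val := by
      by_contra h; exact hj ((hK j).2 (by omega))
    rw [← Finset.card_filter]
    have : (I.filter (fun i => j.val < r i)).card ≤ (range (c j)).card := by
      apply Finset.card_le_card_of_injOn (fun i => i.val)
      · intro i hi
        simp only [coe_filter, Set.mem_ofPred_eq] at hi
        have := hr i hi.1
        simp
        omega
      · intro a _ b _ h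
        exact Fin.ext h
    simpa using this
  calc ∑ i ∈ I, r i ≤ ∑ i ∈ I, ((∑ j ∈ Kᶜ, if j.val < r i then 1 else 0) + l) := Finset.sum_le_sum h1
    _ = (∑ j ∈ Kᶜ, ∑ i ∈ I, if j.val < r i then 1 else 0) + k * l := by
        rw [Finset.sum_add_distrib, Finset.sum_comm, Finset.sum_const, hIc, smul_eq_mul]
    _ ≤ _ := Nat.add_le_add_right (Finset.sum_le_sum h2) _

lemma aux_lower {m : ℕ} (r : Fin m → ℕ) (hr : Antitone r) (l : ℕ) (I : Finset (Fin m))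
    (hI : ∀ i, i ∈ I ↔ l < r i) : ∀ i, i ∈ I ↔ i.val < I.card := by
  intro i
  constructor
  · intro hi
    have : (Finset.Iic i) ⊆ I := by
      intro x hx
      rw [Finset.mem_Iic] at hx
      rw [hI] at hi ⊢
      exact lt_of_lt_of_le hi (hr hx)
    have := Finset.card_le_card this
    rw [Fin.card_Iic] at this
    omega
  · intro hi
    by_contra h
    have : I ⊆ Finset.Iio i := by
      intro x hx
      rw [Finset.mem_Iio]
      by_contra h2
      rw [not_lt] at h2
      apply h
      rw [hI] at hx ⊢
      exact lt_of_lt_of_le hx (hr h2)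
    have := Finset.card_le_card this
    rw [Fin.card_Iio] at this
    omega

/-- toggle lemma -/
lemma aux_toggle {m : ℕ} (r : Fin m → ℕ) (M : ℤ) (hM : 2 ≤ M) (l : ℕ) (I : Finset (Fin m))
    (h : ∀ I' : Finset (Fin m),
      M * (∑ i ∈ I', (r i : ℤ) - I'.card * l) - I'.card ≤ M * (∑ i ∈ I, (r i : ℤ) - I.card * l) - I.card) :
    ∀ i, i ∈ I ↔ l < r i := by
  intro i
  constructor
  · intro hi
    by_contra hn
    have h1 := h (I.erase i)
    have h2 := Finset.add_sum_erase I (fun i => (r i : ℤ)) hi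
    have h3 := Finset.card_erase_add_one hi
    rw [← h2, ← h3] at h1
    push_cast at h1
    have : (r i : ℤ) ≤ l := by exact_mod_cast not_lt.1 hn
    nlinarith
  · intro hl
    by_contra hi
    have h1 := h (insert i I)
    rw [Finset.sum_insert hi, Finset.card_insert_of_notMem hi] at h1
    push_cast at h1
    have : (l : ℤ) + 1 ≤ r i := by exact_mod_cast hl
    nlinarith

lemma aux_main (m : ℕ) (r c : Fin m → ℕ)
    (hsum : ∑ j, r j = ∑ j, c j)
    (hrm : ∀ j, r j ≤ m) (hcm : ∀ j, c j ≤ m)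
    (hrmono : Antitone r) (hcmono : Antitone c)
    (hrstep : ∀ j : Fin m, ∀ h : j.val + 1 < m, r j ≤ r ⟨j.val + 1, h⟩ + 1)
    (hcstep : ∀ j : Fin m, ∀ h : j.val + 1 < m, c j ≤ c ⟨j.val + 1, h⟩ + 1)
    (I K : Finset (Fin m)) (hI : ∀ i, i ∈ I ↔ K.card < r i) (hK : ∀ i, i ∈ K ↔ I.card < c i) :
    ∑ i ∈ I, r i + ∑ j ∈ K, c j ≤ ∑ j, r j + I.card * K.card := by
  have hI' := aux_lower r hrmono _ I hI
  have hK' := aux_lower c hcmono _ K hK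
  have hRs := Finset.sum_add_sum_compl I r
  have hCs := Finset.sum_add_sum_compl K c
  have hIm : I.card ≤ m := by simpa using Finset.card_le_univ I
  have hKm : K.card ≤ m := by simpa using Finset.card_le_univ K
  rcases Nat.eq_zero_or_pos I.card with h0 | hIpos
  · rw [Finset.card_eq_zero] at h0
    subst h0
    simp
    omega
  rcases Nat.eq_zero_or_pos K.card with h0 | hKpos
  · rw [Finset.card_eq_zero] at h0
    subst h0
    simp
    omega
  rcases hIm.eq_or_lt with h0 | hIlt
  · have : ∑ j ∈ K, c j ≤ K.card * m := Finset.sum_le_card_nsmul K c m (fun x _ => hcm x)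
    rw [h0, mul_comm m]
    omega
  rcases hKm.eq_or_lt with h0 | hKlt
  · have : ∑ j ∈ I, r j ≤ I.card * m := Finset.sum_le_card_nsmul I r m (fun x _ => hrm x)
    rw [h0]
    omega
  have key : ∀ (r c : Fin m → ℕ) (I K : Finset (Fin m)), Antitone r → Antitone c →
      (∀ j : Fin m, ∀ h : j.val + 1 < m, r j ≤ r ⟨j.val + 1, h⟩ + 1) →
      (∀ j : Fin m, ∀ h : j.val + 1 < m, c j ≤ c ⟨j.val + 1, h⟩ + 1) →
      (∀ j, r j ≤ m) →
      (∀ i, i ∈ I ↔ K.card < r i) → (∀ i, i ∈ K ↔ I.card < c i) →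
      (∀ i, i ∈ I ↔ i.val < I.card) → (∀ i, i ∈ K ↔ i.val < K.card) →
      I.card < m → 0 < K.card → K.card < m →
      ∑ i ∈ I, r i ≤ ∑ j ∈ Kᶜ, c j + I.card * K.card := by
    intro r c I K _ _ hrs hcs hrm hI hK hI' hK' hIlt hKpos hKlt
    apply aux_half r c I.card K.card I K hI' rfl hK' hrm
    · intro i hi
      have h1 : ¬ K.card < r ⟨I.card, hIlt⟩ := by
        rw [← hI, hI']; simp
      have h2 := (hI' i).1 hi
      have := aux_step r hrs (I.card - i.val) i ⟨I.card, hIlt⟩ (by simp; omega)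
      omega
    · intro j hj
      have h1 : I.card < c ⟨K.card - 1, by omega⟩ := by
        rw [← hK, hK']
        exact Nat.sub_lt hKpos Nat.one_pos
      have h2 : ¬ j.val < K.card := by rwa [← hK']
      have := aux_step c hcs (j.val - (K.card - 1)) ⟨K.card - 1, by omega⟩ j (by simp; omega)
      omega
  have a := key r c I K hrmono hcmono hrstep hcstep hrm hI hK hI' hK' hIlt hKpos hKlt
  have b := key c r K I hcmono hrmono hcstep hrstep hcm hK hI hK' hI' hKlt hIpos hIlt
  rw [mul_comm K.card] at b
  omega

lemma aux_all (m : ℕ) (r c : Fin m → ℕ)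
    (hsum : ∑ j, r j = ∑ j, c j)
    (hrm : ∀ j, r j ≤ m) (hcm : ∀ j, c j ≤ m)
    (hrmono : Antitone r) (hcmono : Antitone c)
    (hrstep : ∀ j : Fin m, ∀ h : j.val + 1 < m, r j ≤ r ⟨j.val + 1, h⟩ + 1)
    (hcstep : ∀ j : Fin m, ∀ h : j.val + 1 < m, c j ≤ c ⟨j.val + 1, h⟩ + 1)
    (I K : Finset (Fin m)) :
    ∑ i ∈ I, r i + ∑ j ∈ K, c j ≤ ∑ j, r j + I.card * K.card := by
  obtain ⟨⟨I0, K0⟩, -, h⟩ := Finset.exists_max_image (univ : Finset (Finset (Fin m) × Finset (Fin m)))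
    (fun p => (2 * m + 2 : ℤ) * (∑ i ∈ p.1, (r i : ℤ) + ∑ i ∈ p.2, (c i : ℤ) - p.1.card * p.2.card)
      - p.1.card - p.2.card) ⟨(∅, ∅), mem_univ _⟩
  have hM : (2 : ℤ) ≤ 2 * m + 2 := by omega
  have hI := aux_toggle r (2 * m + 2) hM K0.card I0 (by
    intro I'
    have := h (I', K0) (mem_univ _)
    simp only at this
    linarith)
  have hK := aux_toggle c (2 * m + 2) hM I0.card K0 (by
    intro K'
    have := h (I0, K') (mem_univ _)
    simp only at this
    linarith)
  have h1 := aux_main m r c hsum hrm hcm hrmono hcmono hrstep hcstep I0 K0 hI hK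
  have h2 := h (I, K) (mem_univ _)
  simp only at h2
  have hIm : (I.card : ℤ) ≤ m := by exact_mod_cast (by simpa using Finset.card_le_univ I : I.card ≤ m)
  have hKm : (K.card : ℤ) ≤ m := by exact_mod_cast (by simpa using Finset.card_le_univ K : K.card ≤ m)
  zify at h1 ⊢
  by_contra hc
  have h3 : (∑ i, (r i : ℤ)) + 1 ≤ ∑ i ∈ I, (r i : ℤ) + ∑ i ∈ K, (c i : ℤ) - I.card * K.card := by linarith
  have h4 : ∑ i ∈ I0, (r i : ℤ) + ∑ i ∈ K0, (c i : ℤ) - I0.card * K0.card ≤ ∑ i, (r i : ℤ) := by linarith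
  have h5 := mul_le_mul_of_nonneg_left h3 (by linarith : (0 : ℤ) ≤ 2 * m + 2)
  have h6 := mul_le_mul_of_nonneg_left h4 (by linarith : (0 : ℤ) ≤ 2 * m + 2)
  have : (0 : ℤ) ≤ I0.card := by positivity
  have : (0 : ℤ) ≤ K0.card := by positivity
  linarith

theorem stmt2 (m : ℕ) (hm : 1 ≤ m) (r c : Fin m → ℕ)
    (hsum : ∑ j, r j = ∑ j, c j)
    (hrm : ∀ j, r j ≤ m) (hcm : ∀ j, c j ≤ m)
    (hrmono : Antitone r) (hcmono : Antitone c)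
    (hrstep : ∀ j : Fin m, ∀ h : j.val + 1 < m, r j ≤ r ⟨j.val + 1, h⟩ + 1)
    (hcstep : ∀ j : Fin m, ∀ h : j.val + 1 < m, c j ≤ c ⟨j.val + 1, h⟩ + 1) :
    ∃ M : Fin m → Fin m → ℕ,
      (∀ i j, M i j = 0 ∨ M i j = 1) ∧
      (∀ j : Fin m, ∑ k, M j k = r j) ∧
      (∀ k : Fin m, ∑ j, M j k = c k) := by
  classical
  have hall := aux_all m r c hsum hrm hcm hrmono hcmono hrstep hcstep
  -- zero slots of rows, one slots of columns
  let Z : Fin m → Finset (Fin m × ℕ) := fun i => {i} ×ˢ range (m - r i)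
  let O : Fin m → Finset (Fin m × ℕ) := fun j => {j} ×ˢ range (c j)
  let t : Fin m × Fin m → Finset ((Fin m × ℕ) ⊕ (Fin m × ℕ)) := fun p => (Z p.1).disjSum (O p.2)
  have hH : ∀ s : Finset (Fin m × Fin m), s.card ≤ (s.biUnion t).card := by
    intro s
    let I := s.image Prod.fst
    let J := s.image Prod.snd
    have e : s.biUnion t = ((I.biUnion Z).disjSum (J.biUnion O)) := by
      ext x
      rcases x with x | x
      · simp [t, I, J]
      · simp only [t, I, J, Finset.mem_biUnion, Finset.inr_mem_disjSum, Finset.mem_image]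
        constructor
        · rintro ⟨a, h, h'⟩
          exact ⟨a.2, ⟨a, h, rfl⟩, h'⟩
        · rintro ⟨_, ⟨a, h, rfl⟩, h'⟩
          exact ⟨a, h, h'⟩
    have cZ : (I.biUnion Z).card = ∑ i ∈ I, (m - r i) := by
      rw [Finset.card_biUnion]
      · simp [Z]
      · intro x _ y _ hxy
        simp [Z, Finset.disjoint_left]
        grind
    have cO : (J.biUnion O).card = ∑ i ∈ J, c i := by
      rw [Finset.card_biUnion]
      · simp [O]
      · intro x _ y _ hxy
        simp [O, Finset.disjoint_left]
        grind
    rw [e, Finset.card_disjSum, cZ, cO]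
    have hs : s.card ≤ I.card * J.card := by
      rw [← Finset.card_product]
      exact Finset.card_le_card Finset.subset_product
    have h1 := hall I Jᶜ
    have h2 : ∑ i ∈ I, (m - r i) + ∑ i ∈ I, r i = I.card * m := by
      rw [← Finset.sum_add_distrib, Finset.sum_congr rfl (fun i _ => Nat.sub_add_cancel (hrm i))]
      simp
    have h3 := Finset.sum_add_sum_compl J c
    have h4 : J.card + Jᶜ.card = m := by simpa using Finset.card_add_card_compl J
    have h5 : I.card * J.card + I.card * Jᶜ.card = I.card * m := by rw [← mul_add, h4]
    omega
  obtain ⟨f, hf, hft⟩ := (Finset.all_card_le_biUnion_card_iff_exists_injective t).1 hH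
  let M : Fin m → Fin m → ℕ := fun i j => if (f (i, j)).isRight then 1 else 0
  have hcol : ∀ j, ∑ i, M i j ≤ c j := by
    intro j
    simp only [M]
    rw [← Finset.card_filter]
    have : (univ.filter (fun i => (f (i, j)).isRight = true)).card ≤ ((O j).map ⟨Sum.inr, Sum.inr_injective⟩ : Finset ((Fin m × ℕ) ⊕ (Fin m × ℕ))).card := by
      apply Finset.card_le_card_of_injOn (fun i => f (i, j))
      · intro i hi
        have := hft (i, j)
        simp only [coe_filter, Set.mem_ofPred_eq, mem_univ, true_and] at hi
        rcases hx : f (i, j) with x | x <;> rw [hx] at hi this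
        · simp at hi
        · simp [t] at this
          simp [hx, this]
      · intro a _ b _ h
        have := hf h
        simpa using this
    simpa [O] using this
  have hrow : ∀ i, m ≤ ∑ j, M i j + (m - r i) := by
    intro i
    have h0 : ∑ j, M i j = (univ.filter (fun j => (f (i, j)).isRight = true)).card := by
      simp only [M]
      rw [← Finset.card_filter]
    have h1 := Finset.card_filter_add_card_filter_not (s := (univ : Finset (Fin m))) (fun j => (f (i, j)).isRight = true)
    have : (univ.filter (fun j => ¬ (f (i, j)).isRight = true)).card ≤ ((Z i).map ⟨Sum.inl, Sum.inl_injective⟩ : Finset ((Fin m × ℕ) ⊕ (Fin m × ℕ))).card := by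
      apply Finset.card_le_card_of_injOn (fun j => f (i, j))
      · intro j hi
        have := hft (i, j)
        simp only [coe_filter, Set.mem_ofPred_eq, mem_univ, true_and] at hi
        rcases hx : f (i, j) with x | x <;> rw [hx] at hi this
        · simp [t] at this
          simp [hx, this]
        · simp at hi
      · intro a _ b _ h
        have := hf h
        simpa using this
    have h2 : (univ.filter (fun j => ¬ (f (i, j)).isRight = true)).card ≤ m - r i := by
      simpa [Z] using this
    have h3 : (univ : Finset (Fin m)).card = m := by simp
    omega
  have hrow' : ∀ i, r i ≤ ∑ j, M i j := by
    intro i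
    have := hrow i
    have := hrm i
    omega
  have e1 : ∑ i, ∑ j, M i j = ∑ j, ∑ i, M i j := Finset.sum_comm
  have e2 := Finset.sum_le_sum (s := univ) (fun i _ => hrow' i)
  have e3 := Finset.sum_le_sum (s := univ) (fun i _ => hcol i)
  refine ⟨M, ?_, ?_, ?_⟩
  · intro i j
    simp only [M]
    split_ifs <;> simp
  · intro i
    exact ((Finset.sum_eq_sum_iff_of_le (fun i _ => hrow' i)).1 (by omega) i (mem_univ _)).symm
  · intro j
    exact (Finset.sum_eq_sum_iff_of_le (fun i _ => hcol i)).1 (by omega) j (mem_univ _)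
end

section
/- Let m ≥ 1 and let (r_1,...,r_m) be integers satisfying: m ≥ r_1 ≥ r_2 ≥ ... ≥ r_m ≥ 0 and r_{j+1} ≥ r_j − 1 for all 1 ≤ j < m. Then there exists a symmetric m×m matrix of 0s and 1s whose j-th row sum (equivalently, j-th column sum) equals r_j for every j. -/
open Finset

theorem exists_top {α : Type*} [DecidableEq α] (r : α → ℕ) (T : Finset α) (k : ℕ) (hk : k ≤ T.card) :
    ∃ S ⊆ T, S.card = k ∧ ∀ a ∈ S, ∀ b ∈ T, b ∉ S → r b ≤ r a := by
  induction k with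
  | zero => exact ⟨∅, by simp, by simp, by simp⟩
  | succ k ih =>
    obtain ⟨S, hS, hc, h⟩ := ih (by omega)
    have hne : (T \ S).Nonempty := by
      rw [← Finset.card_pos, Finset.card_sdiff_of_subset hS]; omega
    obtain ⟨x, hx, hmax⟩ := Finset.exists_max_image (T \ S) r hne
    rw [Finset.mem_sdiff] at hx
    refine ⟨insert x S, ?_, ?_, ?_⟩
    · exact Finset.insert_subset hx.1 hS
    · rw [Finset.card_insert_of_notMem hx.2, hc]
    · intro a ha b hb hbS
      rw [Finset.mem_insert, not_or] at hbS
      rcases Finset.mem_insert.1 ha with rfl | ha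
      · exact hmax b (Finset.mem_sdiff.2 ⟨hb, hbS.2⟩)
      · exact h a ha b hb hbS.2

theorem main_aux {α : Type*} [DecidableEq α] (n : ℕ) : ∀ (s : Finset α) (r : α → ℕ), s.card = n →
    (∀ i ∈ s, r i ≤ n) →
    (∀ v, ∀ i ∈ s, ∀ j ∈ s, r i ≤ v → v ≤ r j → ∃ k ∈ s, r k = v) →
    ∃ M : α → α → ℕ, (∀ i j, M i j = 0 ∨ M i j = 1) ∧ (∀ i j, M i j = M j i) ∧
      ∀ j ∈ s, ∑ k ∈ s, M j k = r j := by
  induction n with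
  | zero =>
    intro s r hs _ _
    rw [Finset.card_eq_zero] at hs
    subst hs
    exact ⟨fun _ _ => 0, by simp, by simp, by simp⟩
  | succ n ih =>
    intro s r hs hb hgap
    obtain ⟨x, hx, hmax⟩ := Finset.exists_max_image s r (Finset.card_pos.1 (by omega))
    by_cases h0 : r x = 0
    · refine ⟨fun _ _ => 0, by simp, by simp, ?_⟩
      intro j hj
      have := hmax j hj
      simp; omega
    have hTc : (s.erase x).card = n := by rw [Finset.card_erase_of_mem hx]; omega
    have hxb := hb x hx
    obtain ⟨S, hST, hSc, htop⟩ := exists_top r (s.erase x) (r x - 1) (by omega)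
    have hxS : x ∉ S := fun h => by simpa using hST h
    have hSs : ∀ a ∈ S, a ∈ s := fun a h => Finset.mem_of_mem_erase (hST h)
    have hpos : ∀ a ∈ S, 1 ≤ r a := by
      intro a ha
      by_contra hcon
      have ha0 : r a = 0 := by omega
      have hsub : Finset.range (r x) ⊆ S.image r := by
        intro v hv
        rw [Finset.mem_range] at hv
        rcases Nat.eq_zero_or_pos v with rfl | hvp
        · exact Finset.mem_image.2 ⟨a, ha, ha0⟩
        · obtain ⟨k, hk, hkv⟩ := hgap v a (hSs a ha) x hx (by omega) (by omega)
          have hkx : k ≠ x := by rintro rfl; omega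
          refine Finset.mem_image.2 ⟨k, ?_, hkv⟩
          by_contra hkS
          have := htop a ha k (Finset.mem_erase.2 ⟨hkx, hk⟩) hkS
          omega
      have h1 := Finset.card_le_card hsub
      have h2 := Finset.card_image_le (s := S) (f := r)
      rw [Finset.card_range] at h1
      omega
    let r' : α → ℕ := fun i => if i ∈ S then r i - 1 else r i
    have hr1 : ∀ i ∈ S, r' i = r i - 1 := fun i h => if_pos h
    have hr2 : ∀ i, i ∉ S → r' i = r i := fun i h => if_neg h
    obtain ⟨M, hM01, hMs, hMr⟩ := ih (s.erase x) r' hTc (by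
      intro i hi
      have his := Finset.mem_of_mem_erase hi
      have := hb i his
      have := hmax i his
      by_cases hiS : i ∈ S
      · rw [hr1 i hiS]; omega
      · rw [hr2 i hiS]
        by_contra hcon
        have : S = s.erase x := Finset.eq_of_subset_of_card_le hST (by omega)
        exact hiS (this ▸ hi)) (by
      intro v i hi j hj hiv hvj
      by_cases e1 : r' i = v
      · exact ⟨i, hi, e1⟩
      by_cases e2 : r' j = v
      · exact ⟨j, hj, e2⟩
      have his := Finset.mem_of_mem_erase hi
      have hjs := Finset.mem_of_mem_erase hj
      have hjm := hmax j hjs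
      have hi' : r i ≤ v := by
        by_cases h : i ∈ S
        · rw [hr1 i h] at *; omega
        · rw [hr2 i h] at *; omega
      have hj' : v + 1 ≤ r j := by
        by_cases h : j ∈ S
        · rw [hr1 j h] at *; omega
        · rw [hr2 j h] at *; omega
      obtain ⟨k, hk, hkv⟩ := hgap v i his j hjs hi' (by omega)
      have hkT : k ∈ s.erase x := Finset.mem_erase.2 ⟨by rintro rfl; omega, hk⟩
      by_cases hkS : k ∈ S
      · have hjS : j ∈ S := by
          by_contra h
          have := htop k hkS j hj h
          omega
        rw [hr1 j hjS] at *
        obtain ⟨l, hl, hlv⟩ := hgap (v+1) i his j hjs (by omega) (by omega)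
        have hlT : l ∈ s.erase x := Finset.mem_erase.2 ⟨by rintro rfl; omega, hl⟩
        have hlS : l ∈ S := by
          by_contra h
          have := htop k hkS l hlT h
          omega
        exact ⟨l, hlT, by rw [hr1 l hlS]; omega⟩
      · exact ⟨k, hkT, by rw [hr2 k hkS]; exact hkv⟩)
    let c : α → ℕ := fun j => if j ∈ S then 1 else 0
    refine ⟨fun i j => if i = x then (if j = x then 1 else c j) else
      if j = x then c i else M i j, ?_, ?_, ?_⟩
    · intro i j
      have := hM01 i j
      simp only [c]
      split_ifs <;> simp [this]
    · intro i j
      have := hMs i j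
      dsimp only
      split_ifs <;> simp [this]
    · intro j hj
      rw [← Finset.add_sum_erase s _ hx]
      by_cases hjx : j = x
      · subst hjx
        have : ∑ k ∈ s.erase j, (if k = j then 1 else c k) = ∑ k ∈ s.erase j, c k :=
          Finset.sum_congr rfl (fun k hk => if_neg (Finset.ne_of_mem_erase hk))
        simp only [if_true]
        rw [this]
        simp only [c]
        rw [Finset.sum_ite_mem, Finset.inter_eq_right.2 hST]
        simp; omega
      · have hjT : j ∈ s.erase x := Finset.mem_erase.2 ⟨hjx, hj⟩
        have : ∑ k ∈ s.erase x, (if k = x then c j else M j k) = ∑ k ∈ s.erase x, M j k :=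
          Finset.sum_congr rfl (fun k hk => if_neg (Finset.ne_of_mem_erase hk))
        simp only [if_neg hjx, if_true]
        rw [this, hMr j hjT]
        by_cases h : j ∈ S
        · have := hpos j h
          rw [hr1 j h]; simp only [c, if_pos h]; omega
        · rw [hr2 j h]; simp only [c, if_neg h]; omega

theorem stmt3 (m : ℕ) (hm : 1 ≤ m) (r : Fin m → ℕ)
    (hrm : ∀ j, r j ≤ m) (hrmono : Antitone r)
    (hrstep : ∀ j : Fin m, ∀ h : j.val + 1 < m, r j ≤ r ⟨j.val + 1, h⟩ + 1) :
    ∃ M : Fin m → Fin m → ℕ,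
      (∀ i j, M i j = 0 ∨ M i j = 1) ∧
      (∀ i j, M i j = M j i) ∧
      (∀ j : Fin m, ∑ k, M j k = r j) := by
  obtain ⟨M, h1, h2, h3⟩ := main_aux m (Finset.univ : Finset (Fin m)) r (by simp)
    (fun i _ => hrm i) (by
      intro v i _ j _ hi hj
      obtain ⟨k, hk, hmax⟩ := Finset.exists_max_image
        (Finset.univ.filter (fun k : Fin m => v ≤ r k)) id ⟨j, by simpa using hj⟩
      simp only [Finset.mem_filter, Finset.mem_univ, true_and, id] at hk hmax
      refine ⟨k, Finset.mem_univ _, ?_⟩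
      by_contra hne
      by_cases hl : k.val + 1 < m
      · have a := hrstep k hl
        have b := hmax ⟨k.val + 1, hl⟩ (by omega)
        rw [Fin.le_def] at b
        simp at b
      · have : i ≤ k := by rw [Fin.le_def]; omega
        have := hrmono this
        omega)
  exact ⟨M, h1, h2, fun j => h3 j (Finset.mem_univ j)⟩
end

section
/- For every positive integer m and every integer n with binomial(m+1,2) ≤ n ≤ J(m), there exist two partitions A_1,...,A_p and B_1,...,B_q of {1,...,n} having the Knowlton–Graham property and order m, where J(m) = Σ_{j=1}^m j·⌊m/j⌋. -/
open Finset

/-- A 0-1 matrix on `S × S` with row and column sums `d`. -/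
def Feas (d : ℕ → ℕ) (S : Finset ℕ) (M : ℕ → ℕ → ℕ) : Prop :=
  (∀ i ∈ S, ∀ k ∈ S, M i k ≤ 1) ∧ (∀ i ∈ S, ∑ k ∈ S, M i k = d i) ∧
    (∀ k ∈ S, ∑ i ∈ S, M i k = d k)

lemma feas_step (d : ℕ → ℕ) (S : Finset ℕ) (x : ℕ) (hx : x ∉ S) (M N : ℕ → ℕ → ℕ) (c : ℕ)
    (hM : Feas d S M) (hN : ∀ i ∈ S, ∀ k ∈ S, N i k ≤ M i k)
    (hr : ∀ i ∈ S, ∑ k ∈ S, N i k ≤ 1) (hc : ∀ k ∈ S, ∑ i ∈ S, N i k ≤ 1) (hc1 : c ≤ 1)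
    (he : c + ∑ i ∈ S, ∑ k ∈ S, N i k = d x) :
    ∃ M', Feas d (insert x S) M' := by
  obtain ⟨h1, h2, h3⟩ := hM
  have hne : ∀ i ∈ S, i ≠ x := fun i hi h => hx (h ▸ hi)
  refine ⟨fun i k => if i = x then (if k = x then c else ∑ i ∈ S, N i k) else
    if k = x then ∑ k ∈ S, N i k else M i k - N i k, ?_, ?_, ?_⟩
  · intro i hi k hk
    rw [mem_insert] at hi hk
    rcases hi with rfl | hi
    · rcases hk with rfl | hk
      · simpa using hc1
      · simpa [hne k hk] using hc k hk
    · rcases hk with rfl | hk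
      · simpa [hne i hi] using hr i hi
      · have := h1 i hi k hk
        simp only [hne i hi, hne k hk, if_false]
        omega
  · intro i hi
    rw [mem_insert] at hi
    rw [sum_insert hx]
    rcases hi with rfl | hi
    · simp only [if_true]
      rw [← he, sum_comm]
      congr 1
      exact sum_congr rfl fun k hk => by simp [hne k hk]
    · simp only [hne i hi, if_false, if_true]
      rw [← h2 i hi, ← sum_add_distrib]
      refine sum_congr rfl fun k hk => ?_
      have := hN i hi k hk
      simp only [hne k hk, if_false]
      omega
  · intro i hi
    rw [mem_insert] at hi
    rw [sum_insert hx]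
    rcases hi with rfl | hi
    · simp only [if_true]
      rw [← he]
      congr 1
      exact sum_congr rfl fun k hk => by simp [hne k hk]
    · simp only [hne i hi, if_false, if_true]
      rw [← h3 i hi, ← sum_add_distrib]
      refine sum_congr rfl fun k hk => ?_
      have := hN k hk i hi
      simp only [hne k hk, if_false]
      omega

lemma exists_matching (d : ℕ → ℕ) (m q : ℕ) (S : Finset ℕ) (M : ℕ → ℕ → ℕ) (hM : Feas d S M)
    (hS : Icc (q + 1) m ⊆ S) (hd : ∀ j ∈ Icc (q + 1) m, d j = m - j) (e : ℕ)
    (he : e ≤ m - 1 - q) :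
    ∃ N : ℕ → ℕ → ℕ, (∀ i ∈ S, ∀ k ∈ S, N i k ≤ M i k) ∧ (∀ i ∈ S, ∑ k ∈ S, N i k ≤ 1) ∧
      (∀ k ∈ S, ∑ i ∈ S, N i k ≤ 1) ∧ ∑ i ∈ S, ∑ k ∈ S, N i k = e := by
  classical
  obtain ⟨h1, h2, h3⟩ := hM
  have hT : ∀ u ∈ Icc (q + 1) (m - 1), u ∈ Icc (q + 1) m := by
    intro u hu; rw [mem_Icc] at *; omega
  have hcard : ∀ u ∈ Icc (q + 1) (m - 1), #(S.filter fun k => M u k = 1) = m - u := by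
    intro u hu
    rw [← hd u (hT u hu), ← h2 u (hS (hT u hu)), card_filter]
    refine sum_congr rfl fun k hk => ?_
    have := h1 u (hS (hT u hu)) k hk
    split_ifs <;> omega
  have hall := (Finset.all_card_le_biUnion_card_iff_exists_injective
    (fun u : {u // u ∈ Icc (q + 1) (m - 1)} => S.filter fun k => M u.1 k = 1)).1 (by
      intro A
      rcases A.eq_empty_or_nonempty with rfl | hA
      · simp
      obtain ⟨u, hu, hmin⟩ := A.exists_min_image (fun u => u.1) hA
      calc #A = #(A.image Subtype.val) := (card_image_of_injective _ Subtype.val_injective).symm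
        _ ≤ #(Icc u.1 (m - 1)) := by
          refine card_le_card ?_
          intro y hy
          obtain ⟨z, hz, rfl⟩ := mem_image.1 hy
          have := z.2
          rw [mem_Icc] at *
          exact ⟨hmin z hz, this.2⟩
        _ ≤ m - u.1 := by
          have := u.2
          rw [mem_Icc] at this
          simp; omega
        _ = _ := (hcard u.1 u.2).symm
        _ ≤ _ := card_le_card (subset_biUnion_of_mem (fun u : {u // u ∈ Icc (q + 1) (m - 1)} =>
            S.filter fun k => M u.1 k = 1) hu))
  obtain ⟨f, hf, hfm⟩ := hall
  obtain ⟨U, hU, hUe⟩ := exists_subset_card_eq (s := Icc (q + 1) (m - 1)) (n := e) (by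
    simp; omega)
  let φ : ℕ → ℕ := fun u => if h : u ∈ Icc (q + 1) (m - 1) then f ⟨u, h⟩ else 0
  have hφ : ∀ u ∈ U, φ u ∈ S ∧ M u (φ u) = 1 := by
    intro u hu
    have := hfm ⟨u, hU hu⟩
    simp only [φ, dif_pos (hU hu)]
    simpa using this
  have hinj : ∀ u ∈ U, ∀ v ∈ U, φ u = φ v → u = v := by
    intro u hu v hv h
    simp only [φ, dif_pos (hU hu), dif_pos (hU hv)] at h
    simpa using hf h
  have hrow : ∀ i, ∑ k ∈ S, (if i ∈ U ∧ φ i = k then 1 else 0) = if i ∈ U then 1 else 0 := by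
    intro i
    by_cases hi : i ∈ U
    · simp [hi, (hφ i hi).1]
    · simp [hi]
  refine ⟨fun i k => if i ∈ U ∧ φ i = k then 1 else 0, ?_, ?_, ?_, ?_⟩
  · intro i hi k hk
    dsimp only
    split_ifs with h
    · rw [← h.2, (hφ i h.1).2]
    · omega
  · intro i hi
    rw [hrow]; split_ifs <;> omega
  · intro k hk
    rw [← card_filter, card_le_one]
    intro a ha b hb
    simp only [mem_filter] at ha hb
    exact hinj a ha.2.1 b hb.2.1 (ha.2.2.trans hb.2.2.symm)
  · simp only [hrow]
    rw [← card_filter, ← hUe]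
    congr 1
    ext u
    simp only [mem_filter]
    exact ⟨fun h => h.2, fun h => ⟨hS (hT u (hU h)), h⟩⟩

lemma exists_feas (d : ℕ → ℕ) (m q : ℕ) (hq : q ≤ m)
    (hd : ∀ j ∈ Icc (q + 1) m, d j = m - j)
    (hd' : ∀ j ∈ Icc 1 q, d j ≤ m - q) : ∃ M, Feas d (Icc 1 m) M := by
  classical
  have key : ∀ E : Finset ℕ, E ⊆ Icc 1 q → ∃ M, Feas d (E ∪ Icc (q + 1) m) M := by
    intro E
    induction E using Finset.induction_on with
    | empty =>
      intro _
      rw [empty_union]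
      have base : ∀ i ∈ Icc (q + 1) m,
          ∑ k ∈ Icc (q + 1) m, (if i + k ≤ m + q then 1 else 0) = d i := by
        intro i hi
        rw [hd i hi, ← card_filter]
        rw [mem_Icc] at hi
        have : (Icc (q + 1) m).filter (fun k => i + k ≤ m + q) = Icc (q + 1) (m + q - i) := by
          ext k; simp only [mem_filter, mem_Icc]; omega
        rw [this]; simp; omega
      refine ⟨fun i k => if i + k ≤ m + q then 1 else 0, ?_, base, ?_⟩
      · intro i _ k _
        dsimp only
        split_ifs <;> omega
      · intro k hk
        rw [← base k hk]
        exact sum_congr rfl fun i _ => by simp only [add_comm k i]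
    | insert x E hx ih =>
      intro hE
      obtain ⟨M, hM⟩ := ih ((subset_insert x E).trans hE)
      have hxq := hE (mem_insert_self x E)
      have hdx := hd' x hxq
      rw [mem_Icc] at hxq
      have hxS : x ∉ E ∪ Icc (q + 1) m := by
        rw [mem_union, mem_Icc]; rintro (h | h)
        · exact hx h
        · omega
      obtain ⟨e, c, he, hc, hec⟩ : ∃ e c, e ≤ m - 1 - q ∧ c ≤ 1 ∧ c + e = d x := by
        by_cases h : d x ≤ m - 1 - q
        · exact ⟨d x, 0, h, by omega, by omega⟩
        · exact ⟨d x - 1, 1, by omega, by omega, by omega⟩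
      obtain ⟨N, n1, n2, n3, n4⟩ := exists_matching d m q _ M hM subset_union_right hd e he
      rw [insert_union]
      exact feas_step d _ x hxS M N c hM n1 n2 n3 hc (by rw [n4, hec])
  obtain ⟨M, hM⟩ := key (Icc 1 q) subset_rfl
  refine ⟨M, ?_⟩
  convert hM using 1
  ext k; simp only [mem_union, mem_Icc]; omega

lemma exists_part {α : Type*} [DecidableEq α] (f : α → ℕ) (s : Finset α)
    (h0 : ∀ x ∈ s, 0 < f x) (h : ∀ j, j ∣ #(s.filter fun x => f x = j)) :
    ∃ P : Finpartition s, ∀ A ∈ P.parts, ∀ x ∈ A, #A = f x := by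
  induction s using Finset.strongInduction with
  | H s ih =>
    rcases s.eq_empty_or_nonempty with rfl | ⟨x, hx⟩
    · exact ⟨Finpartition.empty _, by simp [Finpartition.empty]⟩
    have hpos : 0 < #(s.filter fun y => f y = f x) :=
      card_pos.2 ⟨x, by simp [hx]⟩
    obtain ⟨A, hA, hAc⟩ := exists_subset_card_eq (Nat.le_of_dvd hpos (h (f x)))
    have hAs : A ⊆ s := hA.trans (filter_subset _ _)
    have hAf : ∀ y ∈ A, f y = f x := fun y hy => (mem_filter.1 (hA hy)).2
    have hAn : A.Nonempty := card_pos.1 (hAc ▸ h0 x hx)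
    obtain ⟨P, hP⟩ := ih (s \ A) (sdiff_ssubset hAs hAn)
      (fun y hy => h0 y (mem_sdiff.1 hy).1) (by
        intro j
        have e : (s \ A).filter (fun y => f y = j) =
            (s.filter fun y => f y = j) \ (A.filter fun y => f y = j) := by
          ext y; simp only [mem_filter, mem_sdiff]; tauto
        rw [e, card_sdiff_of_subset (filter_subset_filter _ hAs)]
        refine Nat.dvd_sub (h j) ?_
        by_cases hj : j = f x
        · rw [filter_true_of_mem (fun y hy => (hAf y hy).trans hj.symm), hAc, hj]
        · rw [filter_false_of_mem (fun y hy h' => hj (h'.symm.trans (hAf y hy)))]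
          simp)
    refine ⟨P.extend hAn.ne_empty sdiff_disjoint (sdiff_union_of_subset hAs), ?_⟩
    intro B hB y hy
    simp only [Finpartition.extend, mem_insert] at hB
    rcases hB with rfl | hB
    · rw [hAc, hAf y hy]
    · exact hP B hB y hy

lemma exists_d (m D : ℕ) (hm : 0 < m) (h1 : ∑ j ∈ Icc 1 m, m % j ≤ D)
    (h2 : D ≤ ∑ j ∈ Icc 1 m, (m - j)) :
    ∃ (q : ℕ) (d : ℕ → ℕ), q ≤ m ∧ (∀ j ∈ Icc (q + 1) m, d j = m - j) ∧
      (∀ j ∈ Icc 1 q, d j ≤ m - q) ∧ (∀ j ∈ Icc 1 m, d j ≤ m ∧ j ∣ m - d j) ∧ d m = 0 ∧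
      ∑ j ∈ Icc 1 m, d j = D := by
  classical
  -- `F q` is the least deficit for the threshold `q`
  let g : ℕ → ℕ → ℕ := fun q j => if q < j then m - j else m % j
  let F : ℕ → ℕ := fun q => ∑ j ∈ Icc 1 m, g q j
  have hmodle : ∀ j ∈ Icc 1 m, j ∣ m - m % j := fun j _ => Nat.dvd_sub_mod m
  have hF0 : F 0 = ∑ j ∈ Icc 1 m, (m - j) := sum_congr rfl fun j hj => by
    rw [mem_Icc] at hj; simp only [g]; rw [if_pos (by omega)]
  have hmod : ∀ j, m < 2 * j → j ≤ m → m % j = m - j := by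
    intro j a b
    rw [Nat.mod_eq_sub_mod b, Nat.mod_eq_of_lt (by omega)]
  have hFh : F ((m + 1) / 2) = ∑ j ∈ Icc 1 m, m % j := sum_congr rfl fun j hj => by
    rw [mem_Icc] at hj; simp only [g]; split_ifs with h
    · rw [hmod j (by omega) hj.2]
    · rfl
  have hgm : ∀ q, g q m = 0 := by intro q; simp only [g]; split_ifs <;> simp
  by_cases hD : D = F 0
  · refine ⟨0, fun j => m - j, by omega, fun j _ => rfl, by simp, ?_, by simp, by rw [hD, hF0]⟩
    intro j hj
    rw [mem_Icc] at hj
    dsimp only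
    refine ⟨by omega, ?_⟩
    rw [show m - (m - j) = j by omega]
  have hex : ∃ q, F q ≤ D := ⟨(m + 1) / 2, by rw [hFh]; exact h1⟩
  obtain ⟨q, hqD, hqm⟩ : ∃ q, F q ≤ D ∧ ∀ p, F p ≤ D → q ≤ p :=
    ⟨Nat.find hex, Nat.find_spec hex, fun p hp => Nat.find_min' hex hp⟩
  have hq2 : q ≤ (m + 1) / 2 := hqm _ (by rw [hFh]; exact h1)
  have hq0 : 0 < q := by
    rcases Nat.eq_zero_or_pos q with rfl | h
    · omega
    · exact h
  have hlt : D < F (q - 1) := by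
    by_contra h
    have := hqm (q - 1) (by omega)
    omega
  have hqmem : q ∈ Icc 1 m := by rw [mem_Icc]; omega
  have hdiff : F (q - 1) + m % q = F q + (m - q) := by
    simp only [F]
    rw [← add_sum_erase _ _ hqmem, ← add_sum_erase _ (g q) hqmem]
    have e : ∑ x ∈ (Icc 1 m).erase q, g (q - 1) x = ∑ x ∈ (Icc 1 m).erase q, g q x :=
      sum_congr rfl fun j hj => by
        rw [mem_erase] at hj
        simp only [g]
        by_cases h : q < j
        · rw [if_pos h, if_pos (by omega)]
        · rw [if_neg h, if_neg (by omega)]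
    rw [e]
    have a : g (q - 1) q = m - q := by simp only [g]; rw [if_pos (by omega)]
    have b : g q q = m % q := by simp only [g]; rw [if_neg (by omega)]
    rw [a, b]; omega
  obtain ⟨t, rfl⟩ := Nat.exists_eq_add_of_le hqD
  have htq : t + m % q < m - q := by omega
  have htm : q * (t / q) + t % q = t := Nat.div_add_mod t q
  have htlt : t % q < q := Nat.mod_lt _ hq0
  have h1m : 1 ∈ Icc 1 m := by rw [mem_Icc]; omega
  have hq1 : q = 1 → t % q = 0 := by rintro rfl; simp [Nat.mod_one]
  have hg1 : g q 1 = 0 := by simp only [g]; rw [if_neg (by omega), Nat.mod_one]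
  have hgq : g q q = m % q := by simp only [g]; rw [if_neg (by omega)]
  have hgle : ∀ j, 1 ≤ j → j ≤ q → g q j = m % j ∧ m % j < j := fun j a b =>
    ⟨by simp only [g]; rw [if_neg (by omega)], Nat.mod_lt _ (by omega)⟩
  refine ⟨q, fun j => g q j + (if j = q then q * (t / q) else 0) + (if j = 1 then t % q else 0),
    by omega, ?_, ?_, ?_, ?_, ?_⟩
  · intro j hj
    rw [mem_Icc] at hj
    dsimp only
    rw [if_neg (by omega), if_neg (by omega)]
    simp only [g]
    rw [if_pos (by omega)]; rfl
  · intro j hj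
    rw [mem_Icc] at hj
    have := hgle j hj.1 hj.2
    dsimp only
    by_cases a : j = q
    · subst a
      rw [if_pos rfl, hgq]
      split_ifs <;> omega
    · rw [if_neg a]
      split_ifs with b
      · subst b; omega
      · omega
  · intro j hj
    have hj' := mem_Icc.1 hj
    have hdv : g q j ≤ m ∧ j ∣ m - g q j := by
      simp only [g]
      split_ifs with h
      · exact ⟨by omega, by rw [show m - (m - j) = j by omega]⟩
      · exact ⟨Nat.mod_le _ _, hmodle j hj⟩
    dsimp only
    by_cases b : j = 1
    · subst b
      refine ⟨?_, one_dvd _⟩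
      rw [hg1]
      split_ifs <;> omega
    · rw [if_neg b]
      by_cases a : j = q
      · subst a
        rw [if_pos rfl, hgq, add_zero]
        refine ⟨by omega, ?_⟩
        rw [← Nat.sub_sub]
        exact Nat.dvd_sub (hmodle j hj) (dvd_mul_right _ _)
      · rw [if_neg a]
        simpa using hdv
  · dsimp only
    rw [hgm]
    have : m ≠ q := by omega
    rw [if_neg this]
    split_ifs with h
    · omega
    · rfl
  · rw [sum_add_distrib, sum_add_distrib, sum_ite_eq_of_mem' _ _ _ hqmem,
      sum_ite_eq_of_mem' _ _ _ h1m]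
    simp only [F]; omega

theorem stmt4 (m n : ℕ) (hm : 0 < m)
    (h1 : Nat.choose (m + 1) 2 ≤ n) (h2 : n ≤ J m) :
    ∃ P Q : Finpartition (Finset.univ : Finset (Fin n)),
      KnowltonGraham P Q ∧ KGOrder P Q m := by
  classical
  have hJ : J m + ∑ j ∈ Icc 1 m, m % j = m * m := by
    rw [J, ← sum_add_distrib, sum_congr rfl fun j _ => Nat.div_add_mod m j]
    simp
  have hC : Nat.choose (m + 1) 2 + ∑ j ∈ Icc 1 m, (m - j) = m * m := by
    have a : ∑ j ∈ Icc 1 m, j = Nat.choose (m + 1) 2 := by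
      clear h1 h2 hJ hm
      induction m with
      | zero => rfl
      | succ k ih =>
        rw [sum_Icc_succ_top (by omega), ih, Nat.choose_succ_succ' (k + 1) 1]
        simp [add_comm]
    rw [← a, ← sum_add_distrib,
      sum_congr rfl fun j hj => Nat.add_sub_of_le (mem_Icc.1 hj).2]
    simp
  obtain ⟨q, d, hq, d1, d2, d3, d4, d5⟩ := exists_d m (m * m - n) hm (by omega) (by omega)
  obtain ⟨M, m1, m2, m3⟩ := exists_feas d m q hq d1 d2
  let O : Finset (ℕ × ℕ) := (Icc 1 m ×ˢ Icc 1 m).filter fun p => M p.1 p.2 = 0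
  have hcompl : ∀ i ∈ Icc 1 m, ∀ k ∈ Icc 1 m, (if M i k = 0 then 1 else 0) + M i k = 1 := by
    intro i hi k hk
    have := m1 i hi k hk
    split_ifs <;> omega
  have hrow : ∀ i ∈ Icc 1 m, ∑ k ∈ Icc 1 m, (if M i k = 0 then 1 else 0) = m - d i := by
    intro i hi
    have : ∑ k ∈ Icc 1 m, (if M i k = 0 then 1 else 0) + d i = m := by
      rw [← m2 i hi, ← sum_add_distrib, sum_congr rfl fun k hk => hcompl i hi k hk]
      simp
    omega
  have hcol : ∀ k ∈ Icc 1 m, ∑ i ∈ Icc 1 m, (if M i k = 0 then 1 else 0) = m - d k := by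
    intro k hk
    have : ∑ i ∈ Icc 1 m, (if M i k = 0 then 1 else 0) + d k = m := by
      rw [← m3 k hk, ← sum_add_distrib, sum_congr rfl fun i hi => hcompl i hi k hk]
      simp
    omega
  have hO : #O = n := by
    have a : #O = ∑ i ∈ Icc 1 m, (m - d i) := by
      simp only [O]
      rw [card_filter, sum_product]
      exact sum_congr rfl hrow
    have b : ∑ i ∈ Icc 1 m, (m - d i) + ∑ i ∈ Icc 1 m, d i = m * m := by
      rw [← sum_add_distrib, sum_congr rfl fun j hj => Nat.sub_add_cancel (d3 j hj).1]
      simp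
    omega
  have hOr : ∀ j, j ∣ #(O.filter fun p => p.1 = j) := by
    intro j
    by_cases hj : j ∈ Icc 1 m
    · have : #(O.filter fun p => p.1 = j) = m - d j := by
        rw [← hrow j hj, ← card_filter]
        refine card_bij' (fun p _ => p.2) (fun k _ => (j, k)) ?_ ?_ ?_ ?_
        · rintro ⟨a, b⟩ h
          simp only [O, mem_filter, mem_product] at h ⊢
          obtain ⟨h, rfl⟩ := h
          exact ⟨h.1.2, h.2⟩
        · intro k h
          simp only [O, mem_filter, mem_product] at h ⊢
          exact ⟨⟨⟨hj, h.1⟩, h.2⟩, trivial⟩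
        · rintro ⟨a, b⟩ h
          simp only [mem_filter] at h
          rw [h.2]
        · intro k _; rfl
      rw [this]; exact (d3 j hj).2
    · rw [filter_false_of_mem]
      · simp
      · rintro ⟨a, b⟩ h rfl
        simp only [O, mem_filter, mem_product] at h
        exact hj h.1.1
  have hOc : ∀ j, j ∣ #(O.filter fun p => p.2 = j) := by
    intro j
    by_cases hj : j ∈ Icc 1 m
    · have : #(O.filter fun p => p.2 = j) = m - d j := by
        rw [← hcol j hj, ← card_filter]
        refine card_bij' (fun p _ => p.1) (fun k _ => (k, j)) ?_ ?_ ?_ ?_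
        · rintro ⟨a, b⟩ h
          simp only [O, mem_filter, mem_product] at h ⊢
          obtain ⟨h, rfl⟩ := h
          exact ⟨h.1.1, h.2⟩
        · intro k h
          simp only [O, mem_filter, mem_product] at h ⊢
          exact ⟨⟨⟨h.1, hj⟩, h.2⟩, trivial⟩
        · rintro ⟨a, b⟩ h
          simp only [mem_filter] at h
          rw [h.2]
        · intro k _; rfl
      rw [this]; exact (d3 j hj).2
    · rw [filter_false_of_mem]
      · simp
      · rintro ⟨a, b⟩ h rfl
        simp only [O, mem_filter, mem_product] at h
        exact hj h.1.2
  let ε : Fin n ≃ O := (O.equivFinOfCardEq hO).symm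
  have htr : ∀ (p : ℕ × ℕ → Prop) [DecidablePred p], #((univ : Finset (Fin n)).filter fun x => p (ε x).1) =
      #(O.filter p) := by
    intro p _
    refine card_bij (fun x _ => (ε x).1) ?_ ?_ ?_
    · intro x hx
      exact mem_filter.2 ⟨(ε x).2, (mem_filter.1 hx).2⟩
    · intro x _ y _ h
      exact ε.injective (Subtype.ext h)
    · intro y hy
      rw [mem_filter] at hy
      exact ⟨ε.symm ⟨y, hy.1⟩, by simp [hy.2], by simp⟩
  have hmem : ∀ x, ((ε x).1.1 ∈ Icc 1 m ∧ (ε x).1.2 ∈ Icc 1 m) := by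
    intro x
    have := (ε x).2
    simp only [O, mem_filter, mem_product] at this
    exact this.1
  obtain ⟨P, hP⟩ := exists_part (fun x : Fin n => (ε x).1.1) univ
    (fun x _ => (mem_Icc.1 (hmem x).1).1) (fun j => by rw [htr fun p => p.1 = j]; exact hOr j)
  obtain ⟨Q, hQ⟩ := exists_part (fun x : Fin n => (ε x).1.2) univ
    (fun x _ => (mem_Icc.1 (hmem x).2).1) (fun j => by rw [htr fun p => p.2 = j]; exact hOc j)
  refine ⟨P, Q, ?_, ?_, ?_⟩
  · rintro j k x ⟨⟨A, hA, hxA, hAj⟩, B, hB, hxB, hBk⟩ y ⟨⟨A', hA', hyA, hAj'⟩, B', hB', hyB, hBk'⟩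
    have e1 := hP A hA x hxA
    have e2 := hQ B hB x hxB
    have e3 := hP A' hA' y hyA
    have e4 := hQ B' hB' y hyB
    refine ε.injective (Subtype.ext (Prod.ext ?_ ?_)) <;> omega
  · intro A hA
    rcases mem_union.1 hA with h | h
    · obtain ⟨x, hx⟩ := P.nonempty_of_mem_parts h
      rw [hP A h x hx]
      exact (mem_Icc.1 (hmem x).1).2
    · obtain ⟨x, hx⟩ := Q.nonempty_of_mem_parts h
      rw [hQ A h x hx]
      exact (mem_Icc.1 (hmem x).2).2
  · have hmm : m ∈ Icc 1 m := by rw [mem_Icc]; omega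
    have hz : M m m = 0 := by
      have := m2 m hmm
      rw [d4] at this
      exact (sum_eq_zero_iff.1 this) m hmm
    have hin : (m, m) ∈ O := by simp only [O, mem_filter, mem_product]; exact ⟨⟨hmm, hmm⟩, hz⟩
    obtain ⟨A, hA, hx⟩ := P.exists_mem (mem_univ (ε.symm ⟨(m, m), hin⟩))
    exact ⟨A, mem_union_left _ hA, by rw [hP A hA _ hx]; simp⟩
end

section
/- For every positive integer m and every integer n with binomial(m+1,2) ≤ n ≤ J(m), there exists a symmetric m×m matrix of 0s and 1s whose row sums (t_1,...,t_m) satisfy: j divides t_j and t_j > 0 for every 1 ≤ j ≤ m, and t_1 + ... + t_m = n. Here J(m) = Σ_{j=1}^m j·⌊m/j⌋. -/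
open Finset

def Rz {V : Type} [DecidableEq V] (S : Finset V) (t : V → ℕ) : Prop :=
  ∃ R : V → V → Bool, (∀ v w, R v w = R w v) ∧ ∀ v ∈ S, (S.filter (fun w => R v w = true)).card = t v

lemma Rz_insert {V : Type} [DecidableEq V] (S : Finset V) (x : V) (hx : x ∈ S) (t : V → ℕ)
    (D : Finset V) (hD : D ⊆ S) (hc : D.card = t x) (t' : V → ℕ)
    (ht : ∀ v ∈ S.erase x, t v = t' v + if v ∈ D then 1 else 0)
    (h : Rz (S.erase x) t') : Rz S t := by
  obtain ⟨R, hs, hr⟩ := h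
  refine ⟨fun v w => if v = x then decide (w ∈ D) else if w = x then decide (v ∈ D) else R v w, ?_, ?_⟩
  · intro v w
    have := hs v w
    by_cases h1 : v = x <;> by_cases h2 : w = x <;> simp [h1, h2, this]
  · intro v hv
    by_cases h1 : v = x
    · subst h1
      rw [← hc]
      congr 1
      ext w
      have := @hD w
      simp
      tauto
    · have hv' : v ∈ S.erase x := by simp [h1, hv]
      rw [ht v hv', ← hr v hv']
      conv_lhs => rw [← Finset.insert_erase hx, Finset.filter_insert]
      have e : (S.erase x).filter (fun w => (if v = x then decide (w ∈ D) else if w = x then decide (v ∈ D) else R v w) = true) = (S.erase x).filter (fun w => R v w = true) := by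
        apply Finset.filter_congr
        intro w hw
        simp [h1, (Finset.mem_erase.1 hw).1]
      rw [e]
      by_cases h2 : v ∈ D
      · simp [h1, h2]
      · simp [h1, h2]

lemma Rz_stair {V : Type} [DecidableEq V] (S : Finset V) (m : ℕ) (t : V → ℕ)
    (hinj : Set.InjOn t S) (him : S.image t = Finset.Ioc 0 m) : Rz S t := by
  refine ⟨fun v w => decide (m + 1 ≤ t v + t w), ?_, ?_⟩
  · intro v w; simp [add_comm]
  · intro v hv
    have hvm : t v ∈ Finset.Ioc 0 m := him ▸ Finset.mem_image_of_mem t hv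
    rw [Finset.mem_Ioc] at hvm
    rw [← Finset.card_image_of_injOn (f := t) (hinj.mono (by intro a; simp; tauto))]
    have : (S.filter (fun w => decide (m + 1 ≤ t v + t w) = true)).image t = Finset.Ioc (m - t v) m := by
      ext y
      have hy : y ∈ S.image t ↔ y ∈ Finset.Ioc 0 m := by rw [him]
      simp only [Finset.mem_image, Finset.mem_Ioc, Finset.mem_filter, decide_eq_true_eq] at hy ⊢
      constructor
      · rintro ⟨w, ⟨hw, h⟩, rfl⟩
        have := hy.1 ⟨w, hw, rfl⟩
        omega
      · intro h
        obtain ⟨w, hw, rfl⟩ := hy.2 (by omega)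
        exact ⟨w, ⟨hw, by omega⟩, rfl⟩
    rw [this]; simp; omega

lemma Rz_main {V : Type} [DecidableEq V] (m : ℕ) : ∀ (S K : Finset V) (k : ℕ) (t : V → ℕ),
    K ⊆ S → K.card = k → k ≤ m → (∀ v ∈ K, k ≤ t v ∧ t v ≤ m) →
    Set.InjOn t (S \ K : Finset V) → (S \ K).image t = Finset.Ioc k m → Rz S t := by
  induction m with
  | zero =>
    intro S K k t hK hk hkm hb hinj him
    obtain rfl : k = 0 := by omega
    have : K = ∅ := by simpa using hk
    subst this
    exact Rz_stair S 0 t (by simpa using hinj) (by simpa using him)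
  | succ m ih =>
    intro S K k t hK hk hkm hb hinj him
    rcases Nat.eq_zero_or_pos k with h0 | hk0
    · subst h0
      have : K = ∅ := by simpa using hk
      subst this
      exact Rz_stair S (m+1) t (by simpa using hinj) (by simpa using him)
    have hne : K.Nonempty := Finset.card_pos.1 (by omega)
    obtain ⟨x, hxK, hmax⟩ := Finset.exists_max_image K t hne
    have hBc : (S \ K).card = m + 1 - k := by
      rw [← Finset.card_image_of_injOn hinj, him]; simp
    have hx := hb x hxK
    have hmem : ∀ y, (∃ a ∈ S \ K, t a = y) ↔ (k < y ∧ y ≤ m + 1) := by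
      intro y
      rw [← Finset.mem_Ioc, ← him, Finset.mem_image]
    have hBr : ∀ v ∈ S, v ∉ K → k < t v ∧ t v ≤ m + 1 := fun v hv hv' =>
      (hmem (t v)).1 ⟨v, by simp [hv, hv'], rfl⟩
    have hinj' : ∀ a ∈ S, a ∉ K → ∀ b ∈ S, b ∉ K → t a = t b → a = b := fun a ha ha' b hb hb' h =>
      hinj (by simp [ha, ha']) (by simp [hb, hb']) h
    by_cases hcase : m + 1 - k < t x
    · -- case A
      obtain ⟨D, hD, hDc⟩ := Finset.exists_subset_card_eq (s := K.erase x) (n := t x - (m + 1 - k) - 1)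
        (by rw [Finset.card_erase_of_mem hxK]; omega)
      have hxD : x ∉ D := fun h => by simpa using hD h
      have hDK : ∀ v ∈ D, v ∈ K := fun v h => Finset.mem_of_mem_erase (hD h)
      have hfull : t x = m + 1 → ∀ v ∈ K, v ≠ x → v ∈ D := by
        intro h v hv hvx
        have : D = K.erase x := Finset.eq_of_subset_of_card_le hD (by
          rw [Finset.card_erase_of_mem hxK]; omega)
        rw [this]; simp [hv, hvx]
      let E := (S \ K) ∪ insert x D
      have hE : ∀ v, v ∈ E ↔ (v ∈ S ∧ v ∉ K) ∨ v = x ∨ v ∈ D := by intro v; simp [E]; tauto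
      refine Rz_insert S x (hK hxK) t E ?_ ?_ (fun v => t v - if v ∈ E then 1 else 0) ?_ ?_
      · intro v hv
        rcases (hE v).1 hv with h | h | h
        · exact h.1
        · exact h ▸ hK hxK
        · exact hK (hDK v h)
      · have : Disjoint (S \ K) (insert x D) := by
          rw [Finset.disjoint_left]
          intro a ha hb
          simp at ha hb
          rcases hb with rfl | hb
          · exact ha.2 hxK
          · exact ha.2 (hDK a hb)
        rw [Finset.card_union_of_disjoint this, Finset.card_insert_of_notMem hxD, hBc, hDc]
        omega
      · intro v hv
        have hvS := Finset.mem_of_mem_erase hv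
        have : 0 < t v := by
          by_cases h : v ∈ K
          · have := hb v h; omega
          · have := hBr v hvS h; omega
        try dsimp only
        split_ifs <;> omega
      · have hSK : ∀ a, a ∈ S.erase x \ K.erase x ↔ a ∈ S ∧ a ∉ K := by
          intro a
          simp only [Finset.mem_sdiff, Finset.mem_erase]
          constructor
          · tauto
          · rintro ⟨h1, h2⟩
            refine ⟨⟨?_, h1⟩, by tauto⟩
            rintro rfl; exact h2 hxK
        refine ih (S.erase x) (K.erase x) (k - 1) _ (Finset.erase_subset_erase _ hK)
          (by rw [Finset.card_erase_of_mem hxK, hk]) (by omega) ?_ ?_ ?_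
        · intro v hv
          rw [Finset.mem_erase] at hv
          have h1 := hb v hv.2
          have h2 := hmax v hv.2
          have h3 : t x = m + 1 → v ∈ E := fun h => (hE v).2 (Or.inr (Or.inr (hfull h v hv.2 hv.1)))
          try dsimp only
          split_ifs with h4
          · omega
          · have : t x ≠ m + 1 := fun h => h4 (h3 h)
            omega
        · intro a ha b hb hab
          have ha := (hSK a).1 ha
          have hb := (hSK b).1 hb
          have h1 : a ∈ E := (hE a).2 (Or.inl ha)
          have h2 : b ∈ E := (hE b).2 (Or.inl hb)
          have h3 := hBr a ha.1 ha.2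
          have h4 := hBr b hb.1 hb.2
          simp only [h1, h2, if_true] at hab
          exact hinj' a ha.1 ha.2 b hb.1 hb.2 (by omega)
        · ext y
          rw [Finset.mem_image, Finset.mem_Ioc]
          constructor
          · rintro ⟨a, ha, rfl⟩
            have ha := (hSK a).1 ha
            have h1 : a ∈ E := (hE a).2 (Or.inl ha)
            have h3 := hBr a ha.1 ha.2
            simp only [h1, if_true]
            omega
          · intro hy
            obtain ⟨a, ha, hay⟩ := (hmem (y+1)).2 (by omega)
            have ha := Finset.mem_sdiff.1 ha
            have h1 : a ∈ E := (hE a).2 (Or.inl ha)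
            refine ⟨a, (hSK a).2 ha, ?_⟩
            simp only [h1, if_true]
            omega
    · -- case B
      obtain ⟨y, hy, hty⟩ := (hmem (m + 2 - t x)).2 (by omega)
      have hy := Finset.mem_sdiff.1 hy
      have hyx : y ≠ x := by rintro rfl; exact hy.2 hxK
      let E := (S \ K).filter (fun v => m + 2 - t x ≤ t v)
      have hE : ∀ v, v ∈ E ↔ (v ∈ S ∧ v ∉ K) ∧ m + 2 - t x ≤ t v := by intro v; simp [E]
      refine Rz_insert S x (hK hxK) t E ?_ ?_ (fun v => t v - if v ∈ E then 1 else 0) ?_ ?_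
      · intro v hv; exact ((hE v).1 hv).1.1
      · rw [← Finset.card_image_of_injOn (f := t) (hinj.mono (by intro a; simp [E]; tauto))]
        have : E.image t = Finset.Ioc (m + 1 - t x) (m + 1) := by
          ext z
          rw [Finset.mem_image, Finset.mem_Ioc]
          constructor
          · rintro ⟨a, ha, rfl⟩
            have ha := (hE a).1 ha
            have := hBr a ha.1.1 ha.1.2
            omega
          · intro hz
            obtain ⟨a, ha, rfl⟩ := (hmem z).2 (by omega)
            have ha := Finset.mem_sdiff.1 ha
            exact ⟨a, (hE a).2 ⟨ha, by omega⟩, rfl⟩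
        rw [this]; simp; omega
      · intro v hv
        try dsimp only
        split_ifs with h
        · have := (hE v).1 h
          omega
        · omega
      · have hSK : ∀ a, a ∈ S.erase x \ insert y (K.erase x) ↔ (a ∈ S ∧ a ∉ K) ∧ a ≠ y := by
          intro a
          simp only [Finset.mem_sdiff, Finset.mem_erase, Finset.mem_insert]
          constructor
          · tauto
          · rintro ⟨⟨h1, h2⟩, h3⟩
            refine ⟨⟨?_, h1⟩, by tauto⟩
            rintro rfl; exact h2 hxK
        have hney : ∀ a, a ∈ S → a ∉ K → a ≠ y → t a ≠ m + 2 - t x := by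
          intro a h1 h2 h3 h4
          exact h3 (hinj' a h1 h2 y hy.1 hy.2 (by omega))
        refine ih (S.erase x) (insert y (K.erase x)) k _ ?_ ?_ (by omega) ?_ ?_ ?_
        · intro a ha
          rw [Finset.mem_insert, Finset.mem_erase] at ha
          rw [Finset.mem_erase]
          rcases ha with rfl | ha
          · exact ⟨hyx, hy.1⟩
          · exact ⟨ha.1, hK ha.2⟩
        · rw [Finset.card_insert_of_notMem (by simp [hy.2]), Finset.card_erase_of_mem hxK]
          omega
        · intro v hv
          rw [Finset.mem_insert, Finset.mem_erase] at hv
          try dsimp only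
          rcases hv with rfl | hv
          · rw [if_pos ((hE v).2 ⟨hy, by omega⟩)]
            omega
          · rw [if_neg (fun h => ((hE v).1 h).1.2 hv.2)]
            have h1 := hb v hv.2
            have h2 := hmax v hv.2
            omega
        · intro a ha b hb hab
          have ha := (hSK a).1 ha
          have hb := (hSK b).1 hb
          have h1 := hE a
          have h2 := hE b
          have h3 := hney a ha.1.1 ha.1.2 ha.2
          have h4 := hney b hb.1.1 hb.1.2 hb.2
          simp only [ha.1, true_and, not_false_eq_true] at h1
          simp only [hb.1, true_and, not_false_eq_true] at h2
          simp only [h1, h2] at hab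
          refine hinj' a ha.1.1 ha.1.2 b hb.1.1 hb.1.2 ?_
          split_ifs at hab <;> omega
        · ext z
          rw [Finset.mem_image, Finset.mem_Ioc]
          constructor
          · rintro ⟨a, ha, rfl⟩
            have ha := (hSK a).1 ha
            have h1 := hE a
            have h3 := hney a ha.1.1 ha.1.2 ha.2
            have h4 := hBr a ha.1.1 ha.1.2
            simp only [ha.1, true_and, not_false_eq_true] at h1
            simp only [h1]
            split_ifs <;> omega
          · intro hz
            obtain ⟨a, ha, hay⟩ := (hmem (if m + 2 - t x ≤ z + 1 ∧ m + 2 - t x ≠ z + 1 then z + 1 else z)).2 (by split_ifs <;> omega)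
            have ha := Finset.mem_sdiff.1 ha
            have h1 := hE a
            simp only [ha, true_and, not_false_eq_true] at h1
            refine ⟨a, (hSK a).2 ⟨ha, ?_⟩, ?_⟩
            · rintro rfl
              split_ifs at hay <;> omega
            · simp only [h1]
              split_ifs at hay ⊢ <;> omega

def Sk (m k : ℕ) : ℕ := ∑ j ∈ Finset.Icc 1 m, if j ≤ k then j * (m / j) else j

lemma exists_t (m n : ℕ) (hm : 0 < m) (k : ℕ) (hk : k ≤ m) (h1 : ∑ j ∈ Finset.Icc 1 m, j ≤ n)
    (h2 : n ≤ Sk m k) : ∃ (l : ℕ) (t : ℕ → ℕ), l ≤ m ∧ (∀ j ∈ Finset.Icc 1 m, j ∣ t j) ∧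
      (∀ j, 1 ≤ j → j ≤ l → l ≤ t j ∧ t j ≤ m) ∧ (∀ j, l < j → t j = j) ∧
      ∑ j ∈ Finset.Icc 1 m, t j = n := by
  induction k with
  | zero =>
    have : Sk m 0 = ∑ j ∈ Finset.Icc 1 m, j := by
      apply Finset.sum_congr rfl
      intro j hj
      have := Finset.mem_Icc.1 hj
      rw [if_neg (by omega)]
    exact ⟨0, fun j => j, by omega, by simp, by intros; omega, by simp, by simp only; omega⟩
  | succ k ih =>
    by_cases hn : n ≤ Sk m k
    · exact ih (by omega) hn
    push Not at hn
    have hS : Sk m (k+1) + (k+1) = Sk m k + (k + 1) * (m / (k + 1)) := by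
      have e1 : ∑ j ∈ Finset.Icc 1 m, (if j = k + 1 then (k+1) else 0) = k + 1 := by
        rw [Finset.sum_ite_eq', if_pos (by simp; omega)]
      have e2 : ∑ j ∈ Finset.Icc 1 m, (if j = k + 1 then (k+1) * (m / (k+1)) else 0) = (k + 1) * (m / (k+1)) := by
        rw [Finset.sum_ite_eq', if_pos (by simp; omega)]
      suffices hh : ∑ j ∈ Finset.Icc 1 m, ((if j ≤ k + 1 then j * (m / j) else j) + (if j = k + 1 then (k+1) else 0)) =
          ∑ j ∈ Finset.Icc 1 m, ((if j ≤ k then j * (m / j) else j) + (if j = k + 1 then (k+1) * (m / (k+1)) else 0)) by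
        rw [Finset.sum_add_distrib, Finset.sum_add_distrib, e1, e2] at hh
        exact hh
      apply Finset.sum_congr rfl
      intro j hj
      rcases lt_trichotomy j (k+1) with h | h | h
      · rw [if_pos (by omega : j ≤ k + 1), if_neg (by omega : ¬ j = k + 1), if_pos (by omega : j ≤ k), if_neg (by omega : ¬ j = k + 1)]
      · subst h; simp; omega
      · rw [if_neg (by omega), if_neg (by omega), if_neg (by omega), if_neg (by omega)]
    rcases Nat.eq_zero_or_pos k with rfl | hk0
    · have h0 : Sk m 0 = ∑ j ∈ Finset.Icc 1 m, j := by
        apply Finset.sum_congr rfl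
        intro j hj
        have := Finset.mem_Icc.1 hj
        rw [if_neg (by omega)]
      simp only [zero_add, Nat.div_one, one_mul] at hS h2
      refine ⟨1, fun j => j + if j = 1 then n - Sk m 0 else 0, by omega, ?_, ?_, ?_, ?_⟩
      · intro j hj
        by_cases h : j = 1
        · subst h; simp
        · simp [h]
      · intro j hj hj'
        obtain rfl : j = 1 := by omega
        simp
        omega
      · intro j hj
        simp; omega
      · rw [Finset.sum_add_distrib, Finset.sum_ite_eq', if_pos (by simp; omega)]
        omega
    · set q := k + 1 with hq
      obtain ⟨c, r, hr, hcr⟩ : ∃ c r, r < q ∧ Sk m k + c * q = n + r := by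
        refine ⟨(n - Sk m k + (q - 1)) / q, (q - 1) - (n - Sk m k + (q - 1)) % q, by omega, ?_⟩
        have a1 := Nat.div_add_mod (n - Sk m k + (q - 1)) q
        have a2 := Nat.mod_lt (n - Sk m k + (q - 1)) (show q > 0 by omega)
        rw [mul_comm] at a1
        omega
      have hc1 : c + 1 ≤ m / q := by
        have : c * q < q * (m / q) := by
          omega
        rw [mul_comm] at this
        have := Nat.lt_of_mul_lt_mul_left this
        omega
      have hc0 : 1 ≤ c := by
        rcases Nat.eq_zero_or_pos c with rfl | h
        · omega
        · exact h
      have hcm : (c + 1) * q ≤ m := (Nat.mul_le_mul_right q hc1).trans (Nat.div_mul_le_self m q)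
      have hcq : q ≤ c * q := Nat.le_mul_of_pos_left q hc0
      have hcm' : c * q + q ≤ m := by rw [← Nat.succ_mul]; exact hcm
      refine ⟨q, fun j => if j = 1 then m - r else if j = q then (c + 1) * q else if j ≤ k then j * (m / j) else j, hk, ?_, ?_, ?_, ?_⟩
      · intro j hj
        try dsimp only
        split_ifs with h1 h2 h3
        · simp [h1]
        · simp [h2]
        · simp
        · simp
      · intro j hj hj'
        try dsimp only
        split_ifs with h1 h2 h3
        · omega
        · rw [Nat.succ_mul]; omega
        · have a1 := Nat.div_add_mod m j
          have a2 := Nat.mod_lt m (show j > 0 by omega)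
          omega
        · omega
      · intro j hj
        try dsimp only
        rw [if_neg (by omega), if_neg (by omega), if_neg (by omega)]
      · have e1 : ∑ j ∈ Finset.Icc 1 m, (if j = 1 then r else 0) = r := by
          rw [Finset.sum_ite_eq', if_pos (by simp; omega)]
        have e2 : ∑ j ∈ Finset.Icc 1 m, (if j = q then c * q else 0) = c * q := by
          rw [Finset.sum_ite_eq', if_pos (by simp; omega)]
        apply Nat.add_right_cancel (m := r)
        rw [← hcr]
        suffices hh : ∑ j ∈ Finset.Icc 1 m, ((if j = 1 then m - r else if j = q then (c + 1) * q else if j ≤ k then j * (m / j) else j) + (if j = 1 then r else 0)) =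
            ∑ j ∈ Finset.Icc 1 m, ((if j ≤ k then j * (m / j) else j) + (if j = q then c * q else 0)) by
          rw [Finset.sum_add_distrib, Finset.sum_add_distrib, e1, e2] at hh
          exact hh
        apply Finset.sum_congr rfl
        intro j hj
        have := Finset.mem_Icc.1 hj
        by_cases h1 : j = 1
        · subst h1
          rw [if_pos rfl, if_pos rfl, if_pos (by omega), if_neg (by omega)]
          simp; omega
        · by_cases h2 : j = q
          · rw [if_neg h1, if_pos h2, if_neg h1, if_pos h2, if_neg (by omega), Nat.succ_mul]
            omega
          · rw [if_neg h1, if_neg h2, if_neg h1, if_neg h2]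

theorem stmt5 (m n : ℕ) (hm : 0 < m)
    (h1 : Nat.choose (m + 1) 2 ≤ n) (h2 : n ≤ J m) :
    ∃ M : Fin m → Fin m → ℕ,
      (∀ i j, M i j = 0 ∨ M i j = 1) ∧
      (∀ i j, M i j = M j i) ∧
      (∀ j : Fin m, (j.val + 1) ∣ ∑ k, M j k) ∧
      (∀ j : Fin m, 0 < ∑ k, M j k) ∧
      (∑ j, ∑ k, M j k) = n := by
  have hIcc : ∀ f : ℕ → ℕ, ∑ j ∈ Finset.Icc 1 m, f j = ∑ j : Fin m, f (j.val + 1) := by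
    intro f
    rw [Fin.sum_univ_eq_sum_range (fun j => f (j + 1)) m, ← Finset.Ico_add_one_right_eq_Icc,
      Finset.sum_Ico_eq_sum_range]
    apply Finset.sum_congr (by simp)
    intro j _; rw [add_comm]
  have hsum : ∑ j ∈ Finset.Icc 1 m, j = Nat.choose (m + 1) 2 := by
    rw [hIcc, Fin.sum_univ_eq_sum_range (fun j => j + 1) m, Nat.choose_two_right,
      ← Finset.sum_range_id, Finset.sum_range_succ']
    simp
  have hJ : Sk m m = J m := by
    apply Finset.sum_congr rfl
    intro j hj
    rw [if_pos (Finset.mem_Icc.1 hj).2]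
  obtain ⟨l, t, hl, hd, hlo, hhi, hs⟩ := exists_t m n hm m le_rfl (hsum ▸ h1) (hJ ▸ h2)
  have hK : ∀ a : Fin m, a ∈ Finset.univ \ Finset.univ.filter (fun j : Fin m => j.val + 1 ≤ l) ↔ l < a.val + 1 := by
    intro a; simp
  obtain ⟨R, hR, hRs⟩ := Rz_main m (Finset.univ : Finset (Fin m))
    (Finset.univ.filter (fun j : Fin m => j.val + 1 ≤ l)) l (fun j => t (j.val + 1))
    (Finset.subset_univ _) (by
      have := Fin.card_filter_val_lt (n := m) (m := l)
      simpa [Nat.succ_le_iff, hl] using this) hl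
    (by intro v hv; simp only [Finset.mem_filter] at hv; exact hlo _ (by omega) hv.2)
    (by
      intro a ha b hb hab
      have ha := (hK a).1 ha
      have hb := (hK b).1 hb
      simp only [hhi _ ha, hhi _ hb] at hab
      ext; omega)
    (by
      ext y
      rw [Finset.mem_image, Finset.mem_Ioc]
      constructor
      · rintro ⟨a, ha, rfl⟩
        have ha := (hK a).1 ha
        rw [hhi _ ha]
        have := a.2
        omega
      · intro hy
        have e : y - 1 + 1 = y := by omega
        refine ⟨⟨y - 1, by omega⟩, (hK _).2 (by simp only; omega), ?_⟩
        simp only [e]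
        exact hhi _ hy.1)
  have hrow : ∀ j : Fin m, ∑ k, (if R j k = true then 1 else 0) = t (j.val + 1) := by
    intro j
    have := hRs j (Finset.mem_univ j)
    rw [Finset.card_filter] at this
    exact this
  refine ⟨fun i j => if R i j = true then 1 else 0, ?_, ?_, ?_, ?_, ?_⟩
  · intro i j; dsimp only; split_ifs <;> simp
  · intro i j; simp only [hR i j]
  · intro j
    rw [hrow]
    exact hd _ (by have := j.2; simp)
  · intro j
    rw [hrow]
    by_cases h : j.val + 1 ≤ l
    · have := hlo _ (by omega) h
      omega
    · rw [hhi _ (by omega)]; omega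
  · simp only [hrow]
    rw [← hIcc t, hs]
end

section
/- Let m ≥ 1 and let M be an m×m matrix of 0s and 1s with row sums (r_1,...,r_m) and column sums (c_1,...,c_m) such that j divides r_j and j divides c_j for all 1 ≤ j ≤ m. If r_m + c_m > 0, then r_j > 0 and c_j > 0 for all 1 ≤ j ≤ m, and moreover r_m = c_m = m. -/
open Finset

lemma aux_full (m : ℕ) (hm : 1 ≤ m) (f : Fin m → ℕ) (h : ∀ i, f i = 0 ∨ f i = 1)
    (hd : m ∣ ∑ k, f k) (hp : 0 < ∑ k, f k) : (∑ k, f k) = m ∧ ∀ k, f k = 1 := by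
  have hle : ∀ k ∈ (univ : Finset (Fin m)), f k ≤ 1 := fun k _ => by
    rcases h k with h | h <;> omega
  have h1 : ∑ k, f k ≤ ∑ _k : Fin m, 1 := Finset.sum_le_sum hle
  have h2 : ∑ _k : Fin m, 1 = m := by simp
  have h3 : (∑ k, f k) = m := le_antisymm (by omega) (Nat.le_of_dvd hp hd)
  refine ⟨h3, fun k => ?_⟩
  exact (Finset.sum_eq_sum_iff_of_le hle).1 (h3.trans h2.symm) k (mem_univ k)

lemma aux_pos (m : ℕ) (f : Fin m → ℕ) (i : Fin m) (h : f i = 1) : 0 < ∑ k, f k := by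
  have := Finset.single_le_sum (f := f) (fun k _ => Nat.zero_le _) (mem_univ i)
  omega

theorem stmt12 (m : ℕ) (hm : 1 ≤ m) (M : Fin m → Fin m → ℕ)
    (h01 : ∀ i j, M i j = 0 ∨ M i j = 1)
    (hr : ∀ j : Fin m, (j.val + 1) ∣ ∑ k, M j k)
    (hc : ∀ j : Fin m, (j.val + 1) ∣ ∑ k, M k j)
    (hlast : 0 < (∑ k, M ⟨m - 1, by omega⟩ k) + (∑ k, M k ⟨m - 1, by omega⟩)) :
    (∀ j : Fin m, 0 < ∑ k, M j k) ∧ (∀ j : Fin m, 0 < ∑ k, M k j) ∧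
    (∑ k, M ⟨m - 1, by omega⟩ k) = m ∧ (∑ k, M k ⟨m - 1, by omega⟩) = m := by
  have hl : m - 1 < m := by omega
  have e : m - 1 + 1 = m := by omega
  have hR := hr ⟨m - 1, hl⟩
  have hC := hc ⟨m - 1, hl⟩
  simp only [e] at hR hC
  have fR := aux_full m hm (fun k => M ⟨m - 1, hl⟩ k) (fun k => h01 _ _) hR
  have fC := aux_full m hm (fun k => M k ⟨m - 1, hl⟩) (fun k => h01 _ _) hC
  have pC : (∀ k, M ⟨m - 1, hl⟩ k = 1) → ∀ j, 0 < ∑ k, M k j := fun h j =>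
    aux_pos m (fun k => M k j) ⟨m - 1, hl⟩ (h j)
  have pR : (∀ k, M k ⟨m - 1, hl⟩ = 1) → ∀ j, 0 < ∑ k, M j k := fun h j =>
    aux_pos m (fun k => M j k) ⟨m - 1, hl⟩ (h j)
  rcases Nat.add_pos_iff_pos_or_pos.1 hlast with h | h
  · have a := pC (fR h).2
    have b := fC (a _)
    exact ⟨pR b.2, a, (fR h).1, b.1⟩
  · have a := pR (fC h).2
    have b := fR (a _)
    exact ⟨a, pC b.2, b.1, (fC h).1⟩
end

section
/- For every positive integer m and every integer n with binomial(m+1,2) ≤ n ≤ J(m), there exist nonnegative integers t_1,...,t_m and an integer s with 0 ≤ s ≤ m/2 such that: j divides t_j for every 1 ≤ j ≤ m; t_j ≤ m for every j; t_1 + ... + t_m = n; and the set of values {t_1,...,t_m} equals the set of consecutive integers {s+1, s+2, ..., m}. Here J(m) = Σ_{j=1}^m j·⌊m/j⌋. -/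
open Finset

theorem aux_c (lo hi d p q x : ℕ) (hpq : p ≤ q) (h : lo + d ≤ hi + 1)
    (h1 : lo + d * p ≤ x) (h2 : x ≤ hi + d * q) :
    ∃ c, p ≤ c ∧ c ≤ q ∧ lo + d * c ≤ x ∧ x ≤ hi + d * c := by
  induction q, hpq using Nat.le_induction with
  | base => exact ⟨p, le_rfl, le_rfl, h1, h2⟩
  | succ q hq ih =>
    by_cases hx : x ≤ hi + d * q
    · obtain ⟨c, a1, a2, a3, a4⟩ := ih hx
      exact ⟨c, a1, by omega, a3, a4⟩
    · refine ⟨q + 1, by omega, le_rfl, ?_, h2⟩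
      rw [mul_add]; omega

theorem aux_div (m s j : ℕ) (h : 2 * s ≤ m) (hj : j < s) : s / (j + 1) + 1 ≤ m / (j + 1) := by
  have h1 : (s + (j + 1)) / (j + 1) = s / (j + 1) + 1 := Nat.add_div_right _ (by omega)
  rw [← h1]
  exact Nat.div_le_div_right (by omega)

theorem aux_width (m s k : ℕ) (h : 2 * s ≤ m) (hk : k + 1 ≤ s) :
    ∑ j ∈ range (k + 1), (j + 1) * (s / (j + 1) + 1) + (m - s)
      ≤ ∑ j ∈ range (k + 1), (j + 1) * (m / (j + 1)) + 1 := by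
  induction k with
  | zero => simp; omega
  | succ k ih =>
    rw [sum_range_succ _ (k + 1), sum_range_succ _ (k + 1)]
    have := ih (by omega)
    have h3 := Nat.mul_le_mul_left (k + 1 + 1) (aux_div m s (k + 1) h (by omega))
    omega

theorem aux_a (m s k : ℕ) (h : 2 * s ≤ m) (hk : k + 1 ≤ s) (x : ℕ)
    (h1 : ∑ j ∈ range (k + 1), (j + 1) * (s / (j + 1) + 1) ≤ x)
    (h2 : x ≤ ∑ j ∈ range (k + 1), (j + 1) * (m / (j + 1))) :
    ∃ a : ℕ → ℕ, (∀ j < k + 1, s / (j + 1) + 1 ≤ a j ∧ a j ≤ m / (j + 1)) ∧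
      ∑ j ∈ range (k + 1), (j + 1) * a j = x := by
  induction k generalizing x with
  | zero =>
    refine ⟨fun _ => x, ?_, by simp⟩
    intro j hj
    obtain rfl : j = 0 := by omega
    simp at h1 h2 ⊢
    omega
  | succ k ih =>
    rw [sum_range_succ] at h1 h2
    have hw := aux_width m s k h (by omega)
    obtain ⟨c, c1, c2, c3, c4⟩ := aux_c _ _ (k + 1 + 1) _ _ x
      (aux_div m s (k + 1) h (by omega)) (by omega) h1 h2
    obtain ⟨a, ha, hs⟩ := ih (by omega) (x - (k + 1 + 1) * c) (by omega) (by omega)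
    refine ⟨fun j => if j = k + 1 then c else a j, ?_, ?_⟩
    · intro j hj
      by_cases hjk : j = k + 1
      · subst hjk; simpa using ⟨c1, c2⟩
      · simp only [hjk, if_false]; exact ha j (by omega)
    · rw [sum_range_succ]
      have : ∑ j ∈ range (k + 1), (j + 1) * (if j = k + 1 then c else a j)
          = ∑ j ∈ range (k + 1), (j + 1) * a j := by
        refine sum_congr rfl fun j hj => ?_
        have := mem_range.1 hj
        rw [if_neg (by omega)]
      rw [this, hs]; simp; omega

theorem J_eq (m : ℕ) : J m = ∑ j ∈ range m, (j + 1) * (m / (j + 1)) := by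
  unfold J
  rw [range_eq_Ico, Finset.sum_Ico_add' (fun j => j * (m / j)) 0 m 1]
  rfl

theorem aux_tail (m s k : ℕ) (t : ℕ → ℕ) (hsk : s ≤ k)
    (ht : ∀ j, s ≤ j → j < k → t j = j + 1) :
    ∑ j ∈ range k, t j + ∑ j ∈ range s, (j + 1) = ∑ j ∈ range s, t j + ∑ j ∈ range k, (j + 1) := by
  induction k, hsk using Nat.le_induction with
  | base => rfl
  | succ k hk ih =>
    rw [sum_range_succ, sum_range_succ _ k, ht k hk (by omega)]
    have := ih fun j h1 h2 => ht j h1 (by omega)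
    omega

/-- Construction for a given threshold. -/
theorem aux_main_s13 (m s n : ℕ) (h : 2 * s ≤ m)
    (h1 : J s + ∑ j ∈ range m, (j + 1) ≤ n)
    (h2 : n + ∑ j ∈ range s, (j + 1) ≤
      ∑ j ∈ range s, (j + 1) * (m / (j + 1)) + ∑ j ∈ range m, (j + 1)) :
    ∃ (t : Fin m → ℕ) (s : ℕ), s ≤ m / 2 ∧
      (∀ j : Fin m, (j.val + 1) ∣ t j) ∧
      (∀ j : Fin m, t j ≤ m) ∧
      (∑ j, t j) = n ∧
      (Finset.univ.image t = Finset.Icc (s + 1) m) := by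
  have key : ∃ a : ℕ → ℕ, (∀ j < s, s / (j + 1) + 1 ≤ a j ∧ a j ≤ m / (j + 1)) ∧
      ∑ j ∈ range s, (j + 1) * a j + ∑ j ∈ range m, (j + 1) = n + ∑ j ∈ range s, (j + 1) := by
    rw [J_eq] at h1
    rcases s with _ | k
    · refine ⟨fun _ => 0, by simp, ?_⟩
      simp only [range_zero, sum_empty] at *
      omega
    · have e : ∑ j ∈ range (k + 1), (j + 1) * ((k + 1) / (j + 1) + 1) =
          ∑ j ∈ range (k + 1), (j + 1) * ((k + 1) / (j + 1)) + ∑ j ∈ range (k + 1), (j + 1) := by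
        rw [← sum_add_distrib]; exact sum_congr rfl fun j _ => by ring
      obtain ⟨a, ha, hs⟩ := aux_a m (k + 1) k h le_rfl
        (n + ∑ j ∈ range (k + 1), (j + 1) - ∑ j ∈ range m, (j + 1)) (by omega) (by omega)
      exact ⟨a, ha, by omega⟩
  obtain ⟨a, ha, hs⟩ := key
  have lem : ∀ j, j < m → s + 1 ≤ (if j < s then (j + 1) * a j else j + 1) ∧
      (if j < s then (j + 1) * a j else j + 1) ≤ m := by
    intro j hj
    by_cases hjs : j < s
    · simp only [hjs, if_true]
      obtain ⟨b1, b2⟩ := ha j hjs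
      constructor
      · exact (Nat.lt_mul_div_succ s (Nat.succ_pos j)).trans_le (Nat.mul_le_mul_left _ b1)
      · exact (Nat.mul_le_mul_left _ b2).trans (Nat.mul_div_le m (j + 1))
    · simp only [hjs, if_false]; omega
  refine ⟨fun j => if j.val < s then (j.val + 1) * a j else j.val + 1, s, by omega, ?_, ?_, ?_, ?_⟩
  · intro j
    dsimp only
    split_ifs
    · exact dvd_mul_right _ _
    · exact dvd_rfl
  · intro j; exact (lem j j.2).2
  · rw [Fin.sum_univ_eq_sum_range (fun j => if j < s then (j + 1) * a j else j + 1) m]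
    have := aux_tail m s m (fun j => if j < s then (j + 1) * a j else j + 1) (by omega)
      (fun j h1 _ => by simp; omega)
    have e : ∑ j ∈ range s, (if j < s then (j + 1) * a j else j + 1)
        = ∑ j ∈ range s, (j + 1) * a j :=
      sum_congr rfl fun j hj => by rw [if_pos (mem_range.1 hj)]
    rw [e] at this
    omega
  · ext v
    simp only [mem_image, mem_univ, true_and, mem_Icc]
    constructor
    · rintro ⟨j, rfl⟩; exact lem j j.2
    · rintro ⟨v1, v2⟩
      refine ⟨⟨v - 1, by omega⟩, ?_⟩
      simp only
      rw [if_neg (by omega)]; omega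

theorem aux_gap (m s k : ℕ) (h : 2 * (s + 1) ≤ m) (hk : k + 1 ≤ s) :
    ∑ j ∈ range (k + 1), (j + 1) * ((s + 1) / (j + 1)) + ∑ j ∈ range (k + 1), (j + 1) + s
      ≤ ∑ j ∈ range (k + 1), (j + 1) * (m / (j + 1)) := by
  induction k with
  | zero => simp; omega
  | succ k ih =>
    rw [sum_range_succ _ (k + 1), sum_range_succ _ (k + 1), sum_range_succ _ (k + 1)]
    have := ih (by omega)
    have h3 := Nat.mul_le_mul_left (k + 1 + 1) (aux_div m (s + 1) (k + 1) h (by omega))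
    rw [mul_add] at h3
    omega

theorem aux_gap2 (m s : ℕ) (h : 2 * (s + 1) ≤ m) :
    J (s + 1) + ∑ j ∈ range s, (j + 1) ≤ ∑ j ∈ range s, (j + 1) * (m / (j + 1)) + 1 := by
  rw [J_eq, sum_range_succ, Nat.div_self (by omega)]
  rcases s with _ | k
  · simp
  · have := aux_gap m (k + 1) k h le_rfl
    omega

theorem stmt13 (m n : ℕ) (hm : 0 < m)
    (h1 : Nat.choose (m + 1) 2 ≤ n) (h2 : n ≤ J m) :
    ∃ (t : Fin m → ℕ) (s : ℕ), s ≤ m / 2 ∧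
      (∀ j : Fin m, (j.val + 1) ∣ t j) ∧
      (∀ j : Fin m, t j ≤ m) ∧
      (∑ j, t j) = n ∧
      (Finset.univ.image t = Finset.Icc (s + 1) m) := by
  have hT : ∑ j ∈ range m, (j + 1) = Nat.choose (m + 1) 2 := by
    clear h1 h2 hm
    induction m with
    | zero => simp
    | succ m ih => rw [sum_range_succ, ih, Nat.choose_succ_succ' (m + 1) 1, Nat.choose_one_right, add_comm]
  have hJ0 : J 0 = 0 := rfl
  let P : ℕ → Prop := fun s => J s + ∑ j ∈ range m, (j + 1) ≤ n
  classical
  have hP : P (Nat.findGreatest P (m / 2)) :=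
    Nat.findGreatest_spec (m := 0) (Nat.zero_le _) (by simp only [P]; omega)
  have hle : Nat.findGreatest P (m / 2) ≤ m / 2 := Nat.findGreatest_le _
  have hgt : ∀ k, Nat.findGreatest P (m / 2) < k → k ≤ m / 2 → ¬ P k :=
    fun k => Nat.findGreatest_is_greatest
  generalize Nat.findGreatest P (m / 2) = s at hP hle hgt
  refine aux_main_s13 m s n (by omega) hP ?_
  rcases hle.eq_or_lt with he | hlt
  · have := aux_tail m s m (fun j => (j + 1) * (m / (j + 1))) (by omega) (fun j a b => by
      have : m / (j + 1) = 1 := Nat.div_eq_of_lt_le (by omega) (by omega)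
      simp [this])
    rw [J_eq] at h2
    omega
  · have := hgt (s + 1) (by omega) (by omega)
    simp only [P, not_le] at this
    have := aux_gap2 m s (by omega)
    omega
end
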